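/- arXiv:math/0208006 — 11 statements merged into one kernel-verified Lean document; each statement's English description precedes it below -/
import Mathlib

section
/- A permutation π of {1,…,n} avoids the pattern 321 if and only if the subsequence of π formed by its values at excedance positions is increasing and the subsequence formed by its values at non-excedance positions is increasing. (Equivalently: π is 321-avoiding iff both the subword π_{i_1}⋯π_{i_e} at excedances i_1<…<i_e and the subword π_{j_1}⋯π_{j_{n-e}} at the remaining positions j_1<…<j_{n-e} are increasing.) -/
def Contains {n k : ℕ} (π : Equiv.Perm (Fin n)) (τ : Equiv.Perm (Fin k)) : Prop :=
  ∃ f : Fin k → Fin n, (∀ a b : Fin k, a < b → f a < f b) ∧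
    ∀ a b : Fin k, τ a < τ b ↔ π (f a) < π (f b)

instance {n k : ℕ} (π : Equiv.Perm (Fin n)) (τ : Equiv.Perm (Fin k)) : Decidable (Contains π τ) := by
  unfold Contains; infer_instance

def Avoids {n k : ℕ} (π : Equiv.Perm (Fin n)) (τ : Equiv.Perm (Fin k)) : Prop := ¬ Contains π τ

instance {n k : ℕ} (π : Equiv.Perm (Fin n)) (τ : Equiv.Perm (Fin k)) : Decidable (Avoids π τ) := by
  unfold Avoids; infer_instance

/-- The pattern 132 as a permutation of `Fin 3` (0-indexed values 0,2,1). -/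
def pat132 : Equiv.Perm (Fin 3) := Equiv.swap 1 2

/-- The pattern 321 as a permutation of `Fin 3`. -/
def pat321 : Equiv.Perm (Fin 3) := Fin.revPerm


/-- A permutation avoids 321 iff its values at excedance positions form an
increasing subsequence and its values at non-excedance positions form an
increasing subsequence. -/
theorem stmt0 (n : ℕ) (π : Equiv.Perm (Fin n)) :
    Avoids π pat321 ↔
      ((∀ i j : Fin n, i < j → i < π i → j < π j → π i < π j) ∧
       (∀ i j : Fin n, i < j → ¬ i < π i → ¬ j < π j → π i < π j)) := by
  constructor
  · intro h
    have key : ∀ i j k : Fin n, i < j → j < k → π j < π i → π k < π j → False := by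
      intro i j k hij hjk h1 h2
      apply h
      have hik := hij.trans hjk
      have h3 := h2.trans h1
      refine ⟨![i, j, k], ?_, ?_⟩
      · intro a b hab
        fin_cases a <;> fin_cases b <;> simp_all
      · intro a b
        fin_cases a <;> fin_cases b <;>
          simp [pat321, h1, h2, h3, h1.le, h2.le, h3.le]
    constructor
    · intro i j hij hi hj
      by_contra hlt
      have hne : π i ≠ π j := fun e => hij.ne (π.injective e)
      have hji : π j < π i := lt_of_le_of_ne (not_lt.mp hlt) hne.symm
      have hsub : (Finset.Iio (π j)).image π.symm ⊆ Finset.Iio j := by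
        intro x hx
        obtain ⟨v, hv, rfl⟩ := Finset.mem_image.mp hx
        rw [Finset.mem_Iio] at hv ⊢
        by_contra hc
        rcases lt_or_eq_of_le (not_lt.mp hc) with h4 | h4
        · exact key i j (π.symm v) hij h4 hji (by simpa using hv)
        · rw [h4] at hv
          simp at hv
      have hc := Finset.card_le_card hsub
      rw [Finset.card_image_of_injective _ π.symm.injective, Fin.card_Iio, Fin.card_Iio] at hc
      exact absurd hj (not_lt.mpr hc)
    · intro i j hij hi hj
      by_contra hlt
      have hne : π i ≠ π j := fun e => hij.ne (π.injective e)
      have hji : π j < π i := lt_of_le_of_ne (not_lt.mp hlt) hne.symm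
      have hsub : (insert j (Finset.Iio i)).image π ⊆ Finset.Iio (π i) := by
        intro x hx
        obtain ⟨v, hv, rfl⟩ := Finset.mem_image.mp hx
        rw [Finset.mem_insert, Finset.mem_Iio] at hv
        rw [Finset.mem_Iio]
        rcases hv with rfl | hv
        · exact hji
        · by_contra hc
          rcases lt_or_eq_of_le (not_lt.mp hc) with h4 | h4
          · exact key v i j hv hij h4 hji
          · exact hv.ne (π.injective h4.symm)
      have hc := Finset.card_le_card hsub
      rw [Finset.card_image_of_injective _ π.injective, Finset.card_insert_of_notMem
        (by simpa using hij.le), Fin.card_Iio, Fin.card_Iio] at hc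
      have := Fin.le_def.mp (not_lt.mp hi)
      omega
  · rintro ⟨h1, h2⟩ ⟨f, hf, hp⟩
    have a01 := hf 0 1 (by decide)
    have a12 := hf 1 2 (by decide)
    have b01 := (hp 1 0).mp (by decide)
    have b12 := (hp 2 1).mp (by decide)
    have a02 := a01.trans a12
    have b02 := b12.trans b01
    have p01 := h1 _ _ a01
    have p12 := h1 _ _ a12
    have p02 := h1 _ _ a02
    have q01 := h2 _ _ a01
    have q12 := h2 _ _ a12
    have q02 := h2 _ _ a02
    have c01 := b01.asymm
    have c12 := b12.asymm
    have c02 := b02.asymm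
    tauto
end

section
/- Let π ∈ S_n be a permutation not equal to the identity. Then π avoids the pattern 132 if and only if the cell (1,1) belongs to the diagram D(π) and D(π) is a lower set under the componentwise order, i.e., whenever (i,j) ∈ D(π) and 1 ≤ i' ≤ i, 1 ≤ j' ≤ j, then (i',j') ∈ D(π). (In other words, D(π) consists of a single connected component containing (1,1), namely the Young diagram of a partition.) -/
/-- The diagram of a permutation: cells (i,j) (0-indexed) with j < π i and i < π⁻¹ j. -/
def Diagram {n : ℕ} (π : Equiv.Perm (Fin n)) : Set (Fin n × Fin n) :=
  {p | p.2 < π p.1 ∧ p.1 < π.symm p.2}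

theorem perm_inversion {n : ℕ} (π : Equiv.Perm (Fin n)) (hπ : π ≠ 1) :
    ∃ i k, i < k ∧ π k < π i := by
  by_contra! hc
  apply hπ
  have hm : StrictMono π := fun a b hab =>
    lt_of_le_of_ne (hc a b hab) (fun e => hab.ne (π.injective e))
  have hs : (StrictMono.orderIsoOfSurjective π hm π.surjective) = OrderIso.refl (Fin n) :=
    Subsingleton.elim _ _
  ext x
  have := congrArg (fun e : Fin n ≃o Fin n => e x) hs
  simpa using congrArg Fin.val this

theorem contains132_iff {n : ℕ} (π : Equiv.Perm (Fin n)) :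
    Contains π pat132 ↔ ∃ a b c, a < b ∧ b < c ∧ π a < π c ∧ π c < π b := by
  have p0 : pat132 0 = 0 := by decide
  have p1 : pat132 1 = 2 := by decide
  have p2 : pat132 2 = 1 := by decide
  constructor
  · rintro ⟨f, hf, h⟩
    exact ⟨f 0, f 1, f 2, hf _ _ (by decide), hf _ _ (by decide),
      (h 0 2).1 (by decide), (h 2 1).1 (by decide)⟩
  · rintro ⟨a, b, c, h1, h2, h3, h4⟩
    refine ⟨![a, b, c], ?_, ?_⟩
    · intro x y hxy
      fin_cases x <;> fin_cases y <;> simp at hxy ⊢ <;> first | assumption | exact h1.trans h2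
    · have h5 := h3.trans h4
      intro x y
      fin_cases x <;> fin_cases y <;>
        simp [p0, p1, p2, h3, h4, h5, h3.le, h4.le, h5.le]

/-- A permutation `π ≠ id` avoids 132 iff its diagram contains the cell (1,1)
(here `(⟨0,_⟩,⟨0,_⟩)` in 0-indexed coordinates) and is a lower set under the
componentwise order, i.e. it is the Young diagram of a partition. -/
theorem stmt1 (n : ℕ) (hn : 0 < n) (π : Equiv.Perm (Fin n)) (hπ : π ≠ 1) :
    Avoids π pat132 ↔
      ((⟨0, hn⟩, (⟨0, hn⟩ : Fin n)) ∈ Diagram π ∧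
       ∀ p ∈ Diagram π, ∀ q : Fin n × Fin n, q.1 ≤ p.1 → q.2 ≤ p.2 → q ∈ Diagram π) := by
  have key : Avoids π pat132 → ∀ p ∈ Diagram π, ∀ q : Fin n × Fin n,
      q.1 ≤ p.1 → q.2 ≤ p.2 → q ∈ Diagram π := by
    rintro hav ⟨i, j⟩ ⟨hj, hi⟩ ⟨a, b⟩ ha hb
    simp only at hj hi ha hb
    have main : ∀ c, c ≤ i → ¬ π c ≤ j := by
      intro c hc hcj
      apply hav
      rw [contains132_iff]
      refine ⟨c, i, π.symm j, lt_of_le_of_ne hc ?_, hi, lt_of_le_of_ne ?_ ?_, ?_⟩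
      · rintro rfl
        exact absurd hj (not_lt.2 hcj)
      · simpa using hcj
      · intro e
        have := π.injective e
        rw [← this] at hi
        exact absurd hi (not_lt.2 hc)
      · simpa using hj
    refine ⟨?_, ?_⟩
    · by_contra h
      exact main a ha ((not_lt.1 h).trans hb)
    · by_contra h
      exact main (π.symm b) ((not_lt.1 h).trans ha) (by simpa using hb)
  constructor
  · intro hav
    refine ⟨?_, key hav⟩
    obtain ⟨i, k, hik, hlt⟩ := perm_inversion π hπ
    exact key hav (i, π k) ⟨hlt, by simpa using hik⟩ _ (Fin.mk_le_of_le_val (Nat.zero_le _))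
      (Fin.mk_le_of_le_val (Nat.zero_le _))
  · rintro ⟨_, hl⟩ hc
    obtain ⟨a, b, c, h1, h2, h3, h4⟩ := (contains132_iff π).1 hc
    have := hl (b, π c) ⟨h4, by simpa using h2⟩ (a, π a) h1.le h3.le
    exact absurd this.1 (lt_irrefl _)
end

section
/- For every n ≥ 1 there exists a bijection Φ from the set of 321-avoiding permutations of {1,…,n} to the set of 132-avoiding permutations of {1,…,n} such that for every 321-avoiding permutation π, the excedance set of π equals the descent set of Φ(π); in particular exc(π) = des(Φ(π)) for all π ∈ S_n(321). -/
/-- The set of excedances of `π`, as a set of (0-indexed) positions. -/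
def ExcSet {n : ℕ} (π : Equiv.Perm (Fin n)) : Set ℕ :=
  {i | ∃ h : i < n, (⟨i, h⟩ : Fin n) < π ⟨i, h⟩}

/-- The set of descents of `π`, as a set of (0-indexed) positions. -/
def DesSet {n : ℕ} (π : Equiv.Perm (Fin n)) : Set ℕ :=
  {i | ∃ h : i + 1 < n, π ⟨i + 1, h⟩ < π ⟨i, Nat.lt_of_succ_lt h⟩}

theorem contains321 {n : ℕ} (π : Equiv.Perm (Fin n)) :
    Contains π pat321 ↔ ∃ i j k : Fin n, i < j ∧ j < k ∧ π k < π j ∧ π j < π i := by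
  constructor
  · rintro ⟨f, hf, h⟩
    refine ⟨f 0, f 1, f 2, hf _ _ (by decide), hf _ _ (by decide), ?_, ?_⟩
    · exact (h 2 1).1 (by decide)
    · exact (h 1 0).1 (by decide)
  · rintro ⟨i, j, k, h1, h2, h3, h4⟩
    refine ⟨![i, j, k], ?_, ?_⟩
    · intro a b hab
      fin_cases a <;> fin_cases b <;> simp_all <;> omega
    · intro a b
      fin_cases a <;> fin_cases b <;> simp [pat321, Fin.rev] <;> omega

theorem contains132 {n : ℕ} (π : Equiv.Perm (Fin n)) :
    Contains π pat132 ↔ ∃ i j k : Fin n, i < j ∧ j < k ∧ π i < π k ∧ π k < π j := by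
  have e0 : pat132 0 = 0 := by decide
  have e1 : pat132 1 = 2 := by decide
  have e2 : pat132 2 = 1 := by decide
  constructor
  · rintro ⟨f, hf, h⟩
    refine ⟨f 0, f 1, f 2, hf _ _ (by decide), hf _ _ (by decide), ?_, ?_⟩
    · exact (h 0 2).1 (by decide)
    · exact (h 2 1).1 (by decide)
  · rintro ⟨i, j, k, h1, h2, h3, h4⟩
    refine ⟨![i, j, k], ?_, ?_⟩
    · intro a b hab
      fin_cases a <;> fin_cases b <;> simp_all <;> omega
    · intro a b
      fin_cases a <;> fin_cases b <;> simp [e0, e1, e2] <;> omega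

noncomputable def ins {n : ℕ} (v : Fin (n+1)) (π : Equiv.Perm (Fin n)) :
    Equiv.Perm (Fin (n+1)) :=
  Equiv.ofBijective (Fin.cons v (fun j => v.succAbove (π j))) (by
    rw [← Finite.injective_iff_bijective, Fin.cons_injective_iff]
    refine ⟨?_, ?_⟩
    · rintro ⟨j, hj⟩
      exact Fin.succAbove_ne _ _ hj
    · exact Fin.succAbove_right_injective.comp π.injective)

@[simp] theorem ins_zero {n : ℕ} (v : Fin (n+1)) (π : Equiv.Perm (Fin n)) :
    ins v π 0 = v := by simp [ins]

@[simp] theorem ins_succ {n : ℕ} (v : Fin (n+1)) (π : Equiv.Perm (Fin n)) (j : Fin n) :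
    ins v π j.succ = v.succAbove (π j) := by simp [ins]

theorem ins_inj {n : ℕ} {v w : Fin (n+1)} {π ρ : Equiv.Perm (Fin n)} (h : ins v π = ins w ρ) :
    v = w ∧ π = ρ := by
  have h0 : v = w := by simpa using congrArg (fun f => f 0) h
  subst h0
  refine ⟨rfl, ?_⟩
  ext j
  have := congrArg (fun f => f j.succ) h
  simp only [ins_succ] at this
  rw [Fin.succAbove_right_injective this]

theorem ins_surj {n : ℕ} (ρ : Equiv.Perm (Fin (n+1))) : ∃ v π, ins v π = ρ := by
  have h : ∀ j : Fin n, ∃ k, (ρ 0).succAbove k = ρ j.succ := by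
    intro j
    apply Fin.exists_succAbove_eq
    intro h
    exact Fin.succ_ne_zero j (ρ.injective h)
  choose f hf using h
  have hi : Function.Injective f := by
    intro a b hab
    have := hf a
    rw [hab, hf b] at this
    exact (Fin.succ_injective _ (ρ.injective this)).symm
  refine ⟨ρ 0, Equiv.ofBijective f (Finite.injective_iff_bijective.1 hi), ?_⟩
  ext j
  refine Fin.cases ?_ (fun j => ?_) j
  · simp
  · simp [hf]

theorem sA_lt {n : ℕ} (v : Fin (n+1)) (i : Fin n) (h : (i : ℕ) < v) :
    ((v.succAbove i : Fin (n+1)) : ℕ) = i := by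
  rw [Fin.succAbove_of_castSucc_lt _ _ (by simpa [Fin.lt_def] using h)]; rfl

theorem sA_ge {n : ℕ} (v : Fin (n+1)) (i : Fin n) (h : (v : ℕ) ≤ i) :
    ((v.succAbove i : Fin (n+1)) : ℕ) = i + 1 := by
  rw [Fin.succAbove_of_le_castSucc _ _ (by simpa [Fin.le_def] using h)]; rfl

theorem sA_lt_iff {n : ℕ} (v : Fin (n+1)) (i j : Fin n) :
    v.succAbove i < v.succAbove j ↔ i < j := Fin.succAbove_lt_succAbove_iff

theorem sA_lt_self {n : ℕ} (v : Fin (n+1)) (i : Fin n) :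
    v.succAbove i < v ↔ (i : ℕ) < v := by
  rw [Fin.lt_def]
  rcases lt_or_ge (i : ℕ) v with h | h
  · rw [sA_lt v i h]
  · rw [sA_ge v i h]; omega

def Inc {n : ℕ} (v : ℕ) (π : Equiv.Perm (Fin n)) : Prop :=
  ∀ i j, i < j → π j < π i → v ≤ (π i : ℕ)

open Classical in
noncomputable def q {n : ℕ} (π : Equiv.Perm (Fin n)) : ℕ :=
  Nat.findGreatest (fun v => Inc v π) n

theorem q_le {n : ℕ} (π : Equiv.Perm (Fin n)) : q π ≤ n := by
  classical
  exact Nat.findGreatest_le _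

theorem le_q_iff {n : ℕ} (π : Equiv.Perm (Fin n)) (v : ℕ) (hv : v ≤ n) : v ≤ q π ↔ Inc v π := by
  classical
  constructor
  · intro h
    have : Inc (q π) π := by
      unfold q
      exact Nat.findGreatest_spec (P := fun v => Inc v π) (Nat.zero_le n)
        (fun _ _ _ _ => Nat.zero_le _)
    exact fun i j h1 h2 => h.trans (this i j h1 h2)
  · intro h
    exact Nat.le_findGreatest hv h

theorem av321_ins {n : ℕ} (v : Fin (n+1)) (π : Equiv.Perm (Fin n)) :
    Avoids (ins v π) pat321 ↔ Avoids π pat321 ∧ (v : ℕ) ≤ q π := by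
  rw [le_q_iff _ _ (by omega)]
  unfold Avoids
  rw [contains321, contains321]
  constructor
  · intro h
    constructor
    · rintro ⟨i, j, k, h1, h2, h3, h4⟩
      exact h ⟨i.succ, j.succ, k.succ, by simpa, by simpa, by simpa using h3, by simpa using h4⟩
    · intro i j h1 h2
      by_contra h3
      push Not at h3
      exact h ⟨0, i.succ, j.succ, Fin.succ_pos _, by simpa, by simpa using h2, by
        simpa using (sA_lt_self v (π i)).2 h3⟩
  · rintro ⟨h, hI⟩ ⟨i, j, k, h1, h2, h3, h4⟩
    obtain ⟨j, rfl⟩ := Fin.exists_succ_eq.2 (ne_of_gt (lt_of_le_of_lt (Fin.zero_le _) h1))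
    obtain ⟨k, rfl⟩ := Fin.exists_succ_eq.2 (ne_of_gt (lt_of_le_of_lt (Fin.zero_le _) h2))
    simp only [ins_succ, sA_lt_iff] at h3
    rw [Fin.succ_lt_succ_iff] at h2
    revert h1 h4
    refine Fin.cases ?_ (fun i => ?_) i
    · intro h1 h4
      simp only [ins_succ, ins_zero, sA_lt_self] at h4
      exact absurd (hI j k h2 h3) (by omega)
    · intro h1 h4
      simp only [ins_succ, sA_lt_iff] at h4
      exact h ⟨i, j, k, by simpa using h1, h2, h3, h4⟩

theorem q_ins_pos {n : ℕ} (v : Fin (n+1)) (π : Equiv.Perm (Fin n)) (hv : (v : ℕ) ≤ q π)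
    (h0 : 0 < (v : ℕ)) : q (ins v π) = v := by
  rw [le_q_iff _ _ (by omega)] at hv
  have key : ∀ w : ℕ, w ≤ n + 1 → (w ≤ q (ins v π) ↔ w ≤ v) := by
    intro w hw
    rw [le_q_iff _ _ hw]
    constructor
    · intro h
      have hn : 0 < n := by omega
      obtain ⟨i, hi⟩ := π.surjective ⟨0, hn⟩
      have := h 0 i.succ (Fin.succ_pos _) (by
        simp only [ins_succ, ins_zero, sA_lt_self, hi]; exact h0)
      simpa using this
    · intro h i j
      refine Fin.cases ?_ (fun i => ?_) i
      · intro _ _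
        simpa using h
      · intro h1 h2
        obtain ⟨j, rfl⟩ := Fin.exists_succ_eq.2 (ne_of_gt (lt_of_le_of_lt (Fin.zero_le _) h1))
        simp only [ins_succ, sA_lt_iff] at h2
        have := hv i j (by simpa using h1) h2
        rw [ins_succ, sA_ge _ _ this]
        omega
  have := q_le (ins v π)
  have a := (key v (by omega)).2 le_rfl
  have b := (key _ this).1 le_rfl
  omega

theorem q_ins_zero {n : ℕ} (π : Equiv.Perm (Fin n)) : q (ins 0 π) = q π + 1 := by
  have key : ∀ w : ℕ, w ≤ n → (w + 1 ≤ q (ins 0 π) ↔ w ≤ q π) := by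
    intro w hw
    rw [le_q_iff _ _ (by omega), le_q_iff _ _ hw]
    constructor
    · intro h i j h1 h2
      have := h i.succ j.succ (by simpa using h1) (by simpa using h2)
      simpa using this
    · intro h i j
      refine Fin.cases ?_ (fun i => ?_) i
      · intro _ h2
        simp at h2
      · intro h1 h2
        obtain ⟨j, rfl⟩ := Fin.exists_succ_eq.2 (ne_of_gt (lt_of_le_of_lt (Fin.zero_le _) h1))
        simp only [ins_succ, sA_lt_iff] at h2
        have := h i j (by simpa using h1) h2
        simpa using this
  have h1 := q_le (ins 0 π)
  have h2 := q_le π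
  have a := (key _ h2).2 le_rfl
  have b := (key (q (ins 0 π) - 1) (by omega)).1 (by omega)
  omega

theorem inc_small {n : ℕ} (v : ℕ) (π : Equiv.Perm (Fin n)) (h : Inc v π) (i : Fin n)
    (hi : (π i : ℕ) < v) : π i ≤ i := by
  have hs : Finset.Iio (π i) ⊆ (Finset.Iio i).image π := by
    intro x hx
    rw [Finset.mem_Iio] at hx
    obtain ⟨j, rfl⟩ := π.surjective x
    refine Finset.mem_image_of_mem _ (Finset.mem_Iio.2 ?_)
    by_contra hj
    have hne : i ≠ j := by rintro rfl; exact lt_irrefl _ hx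
    exact absurd (h i j (lt_of_le_of_ne (not_lt.1 hj) hne) hx) (by omega)
  have := (Finset.card_le_card hs).trans Finset.card_image_le
  simpa using this

theorem exc_ins_zero {n : ℕ} (v : Fin (n+1)) (π : Equiv.Perm (Fin n)) :
    0 ∈ ExcSet (ins v π) ↔ 0 < (v : ℕ) := by
  have : (⟨0, n.succ_pos⟩ : Fin (n+1)) = 0 := rfl
  constructor
  · rintro ⟨h, h'⟩
    change (0 : Fin (n+1)) < ins v π 0 at h'
    rw [ins_zero, Fin.lt_def, Fin.val_zero] at h'
    exact h'
  · intro h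
    refine ⟨n.succ_pos, ?_⟩
    change (0 : Fin (n+1)) < ins v π 0
    rw [ins_zero, Fin.lt_def, Fin.val_zero]
    exact h

theorem exc_ins_succ {n : ℕ} (v : Fin (n+1)) (π : Equiv.Perm (Fin n)) (hv : (v : ℕ) ≤ q π)
    (i : ℕ) : i + 1 ∈ ExcSet (ins v π) ↔ i ∈ ExcSet π := by
  rw [le_q_iff _ _ (by omega)] at hv
  have key : ∀ j : Fin n, j.succ < ins v π j.succ ↔ j < π j := by
    intro j
    rw [ins_succ, Fin.lt_def, Fin.lt_def]
    rcases lt_or_ge (π j : ℕ) v with h | h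
    · have := inc_small v π hv j h
      rw [sA_lt _ _ h, Fin.val_succ]
      rw [Fin.le_def] at this
      omega
    · rw [sA_ge _ _ h, Fin.val_succ]; omega
  constructor
  · rintro ⟨h, h'⟩
    exact ⟨by omega, (key ⟨i, by omega⟩).1 h'⟩
  · rintro ⟨h, h'⟩
    exact ⟨by omega, (key ⟨i, by omega⟩).2 h'⟩

/-- parameter on the 132 side -/
def r : {n : ℕ} → Equiv.Perm (Fin n) → ℕ
  | 0, _ => 0
  | n+1, σ => n + 1 - (σ 0 : ℕ)

theorem r_le {n : ℕ} (σ : Equiv.Perm (Fin n)) : r σ ≤ n := by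
  cases n <;> simp [r]

theorem r_ins {n : ℕ} (p : Fin (n+1)) (σ : Equiv.Perm (Fin n)) : r (ins p σ) = n + 1 - p := by
  simp [r]

theorem av132_ins {n : ℕ} (p : Fin (n+1)) (σ : Equiv.Perm (Fin n)) :
    Avoids (ins p σ) pat132 ↔ Avoids σ pat132 ∧ n ≤ p + r σ := by
  unfold Avoids
  rw [contains132, contains132]
  constructor
  · intro h
    constructor
    · rintro ⟨i, j, k, h1, h2, h3, h4⟩
      exact h ⟨i.succ, j.succ, k.succ, by simpa, by simpa, by simpa using h3, by simpa using h4⟩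
    · by_contra hp
      rcases n with _ | n
      · omega
      have hlt : (p : ℕ) < σ 0 := by simp only [r] at hp; omega
      obtain ⟨k, hk⟩ := σ.surjective ⟨p, by omega⟩
      have hk' : (σ k : ℕ) = p := by rw [hk]
      have hk0 : 0 < k := by
        rw [Fin.pos_iff_ne_zero]
        rintro rfl
        omega
      refine h ⟨0, Fin.succ 0, k.succ, Fin.succ_pos _, Fin.succ_lt_succ_iff.2 hk0, ?_, ?_⟩
      · rw [ins_zero, ins_succ, Fin.lt_def, sA_ge _ _ hk'.ge]; omega
      · rw [ins_succ, ins_succ, sA_lt_iff, Fin.lt_def]; omega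
  · rintro ⟨h, hp⟩ ⟨i, j, k, h1, h2, h3, h4⟩
    obtain ⟨j, rfl⟩ := Fin.exists_succ_eq.2 (ne_of_gt (lt_of_le_of_lt (Fin.zero_le _) h1))
    obtain ⟨k, rfl⟩ := Fin.exists_succ_eq.2 (ne_of_gt (lt_of_le_of_lt (Fin.zero_le _) h2))
    simp only [ins_succ, sA_lt_iff] at h4
    rw [Fin.succ_lt_succ_iff] at h2
    revert h1 h3
    refine Fin.cases ?_ (fun i => ?_) i
    · intro h1 h3
      rcases n with _ | n
      · exact k.elim0
      have hle : (σ 0 : ℕ) ≤ p := by simp only [r] at hp; omega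
      have hpk : (p : ℕ) ≤ σ k := by
        by_contra hc
        have := (sA_lt_self p (σ k)).2 (by omega)
        rw [ins_zero, ins_succ] at h3
        exact lt_asymm h3 this
      have hk0 : k ≠ 0 := ne_of_gt (lt_of_le_of_lt (Fin.zero_le _) h2)
      have hne : (σ k : ℕ) ≠ σ 0 := fun e => hk0 (σ.injective (Fin.ext e))
      have h0k : σ 0 < σ k := by rw [Fin.lt_def]; omega
      have hj0 : 0 < j := by
        rw [Fin.pos_iff_ne_zero]
        rintro rfl
        exact lt_asymm h0k h4
      exact h ⟨0, j, k, hj0, h2, h0k, h4⟩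
    · intro h1 h3
      simp only [ins_succ, sA_lt_iff] at h3
      exact h ⟨i, j, k, by simpa using h1, h2, h3, h4⟩

theorem des_ins_zero {n : ℕ} (p : Fin (n+1)) (σ : Equiv.Perm (Fin n)) :
    0 ∈ DesSet (ins p σ) ↔ n < p + r σ := by
  rcases n with _ | n
  · simp [DesSet, r]
  · have key : ins p σ (Fin.succ 0) < ins p σ 0 ↔ n + 1 < p + r σ := by
      rw [ins_succ, ins_zero, sA_lt_self]
      simp only [r]; omega
    rw [← key]
    constructor
    · rintro ⟨_, h⟩; exact h
    · intro h; exact ⟨by omega, h⟩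

theorem des_ins_succ {n : ℕ} (p : Fin (n+1)) (σ : Equiv.Perm (Fin n)) (i : ℕ) :
    i + 1 ∈ DesSet (ins p σ) ↔ i ∈ DesSet σ := by
  have key : ∀ a b : Fin n, ins p σ a.succ < ins p σ b.succ ↔ σ a < σ b := by
    intro a b; rw [ins_succ, ins_succ, sA_lt_iff]
  constructor
  · rintro ⟨h, h'⟩
    exact ⟨by omega, (key ⟨i+1, by omega⟩ ⟨i, by omega⟩).1 h'⟩
  · rintro ⟨h, h'⟩
    exact ⟨by omega, (key ⟨i+1, by omega⟩ ⟨i, by omega⟩).2 h'⟩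

abbrev A3 (n : ℕ) := {π : Equiv.Perm (Fin n) // Avoids π pat321}
abbrev A1 (n : ℕ) := {σ : Equiv.Perm (Fin n) // Avoids σ pat132}

noncomputable def e3 (n : ℕ) : (Σ π : A3 n, Fin (q π.1 + 1)) ≃ A3 (n+1) :=
  Equiv.ofBijective
    (fun x => ⟨ins ⟨x.2, by have := x.2.2; have := q_le x.1.1; omega⟩ x.1.1,
      (av321_ins _ _).2 ⟨x.1.2, by have := x.2.2; simp only; omega⟩⟩) (by
    constructor
    · rintro ⟨⟨π, hπ⟩, v⟩ ⟨⟨ρ, hρ⟩, w⟩ h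
      obtain ⟨h1, h2⟩ := ins_inj (Subtype.mk.inj h)
      simp only at h2
      subst h2
      simp only [Fin.mk.injEq] at h1
      have := Fin.ext h1
      subst this
      rfl
    · rintro ⟨ρ, hρ⟩
      obtain ⟨v, π, rfl⟩ := ins_surj ρ
      have := (av321_ins _ _).1 hρ
      exact ⟨⟨⟨π, this.1⟩, ⟨v, by have := this.2; simp only; omega⟩⟩, rfl⟩)

/-- the 132 side; the label t gives the first value n - t -/
noncomputable def e1 (n : ℕ) : (Σ σ : A1 n, Fin (r σ.1 + 1)) ≃ A1 (n+1) :=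
  Equiv.ofBijective
    (fun x => ⟨ins ⟨n - x.2, by omega⟩ x.1.1,
      (av132_ins _ _).2 ⟨x.1.2, by have := x.2.2; simp only; omega⟩⟩) (by
    constructor
    · rintro ⟨⟨π, hπ⟩, v⟩ ⟨⟨ρ, hρ⟩, w⟩ h
      obtain ⟨h1, h2⟩ := ins_inj (Subtype.mk.inj h)
      simp only at h2
      subst h2
      simp only [Fin.mk.injEq] at h1
      have a := v.2
      have b := w.2
      have c := r_le π
      simp only at a b
      have := Fin.ext (a := v) (b := w) (by omega)
      subst this
      rfl
    · rintro ⟨ρ, hρ⟩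
      obtain ⟨p, σ, rfl⟩ := ins_surj ρ
      have := (av132_ins _ _).1 hρ
      refine ⟨⟨⟨σ, this.1⟩, ⟨n - p, by have := this.2; simp only; omega⟩⟩, ?_⟩
      apply Subtype.ext
      have hp : (⟨n - (n - p), by omega⟩ : Fin (n+1)) = p := by
        apply Fin.ext; simp only; omega
      simp only [hp])

/-- renaming: 0 goes to m, and v+1 goes to v -/
def shuf (m m' : ℕ) (h : m = m') : Fin (m+1) ≃ Fin (m'+1) where
  toFun v := ⟨if (v : ℕ) = 0 then m else v - 1, by split <;> omega⟩
  invFun t := ⟨if (t : ℕ) = m then 0 else t + 1, by have := t.2; split <;> omega⟩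
  left_inv v := by
    apply Fin.ext
    simp only
    split_ifs <;> omega
  right_inv t := by
    apply Fin.ext
    by_cases ht : (t : ℕ) = m
    · simp [ht]
    · simp [ht]

theorem main_ind (n : ℕ) : ∃ Φ : A3 n ≃ A1 n, ∀ π : A3 n,
    ExcSet π.1 = DesSet (Φ π).1 ∧ r (Φ π).1 = q π.1 := by
  induction n with
  | zero =>
    have h3 : ∀ π : Equiv.Perm (Fin 0), Avoids π pat321 := by
      rintro π ⟨f, _⟩; exact (f 0).elim0
    have h1 : ∀ π : Equiv.Perm (Fin 0), Avoids π pat132 := by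
      rintro π ⟨f, _⟩; exact (f 0).elim0
    refine ⟨⟨fun π => ⟨π.1, h1 _⟩, fun π => ⟨π.1, h3 _⟩, fun _ => rfl, fun _ => rfl⟩, ?_⟩
    intro π
    constructor
    · ext i; simp [ExcSet, DesSet]
    · have := q_le π.1
      simp only [r]; omega
  | succ n ih =>
    obtain ⟨Φ, hΦ⟩ := ih
    refine ⟨(e3 n).symm.trans ((Equiv.sigmaCongr Φ
      (fun π => shuf _ _ (hΦ π).2.symm)).trans (e1 n)), ?_⟩
    intro ρ
    obtain ⟨⟨π, v⟩, rfl⟩ := (e3 n).surjective ρ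
    obtain ⟨hE, hr⟩ := hΦ π
    have hvlt := v.2
    have hq := q_le π.1
    have hA : ((e3 n) ⟨π, v⟩).1 = ins ⟨v, by omega⟩ π.1 := rfl
    have hB : (((e3 n).symm.trans ((Equiv.sigmaCongr Φ
      (fun π => shuf _ _ (hΦ π).2.symm)).trans (e1 n))) ((e3 n) ⟨π, v⟩)).1
      = ins ⟨n - (if (v : ℕ) = 0 then q π.1 else v - 1), by omega⟩ (Φ π).1 := by
      simp only [Equiv.trans_apply, Equiv.symm_apply_apply]
      rfl
    rw [hA, hB]
    constructor
    · ext i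
      rcases i with _ | i
      · rw [exc_ins_zero, des_ins_zero, hr]
        simp only
        split_ifs <;> omega
      · rw [exc_ins_succ _ _ (by simp only; omega), des_ins_succ, hE]
    · rw [r_ins]
      simp only
      by_cases h0 : (v : ℕ) = 0
      · have : (⟨v, by omega⟩ : Fin (n+1)) = 0 := Fin.ext h0
        rw [this, q_ins_zero, if_pos h0]; omega
      · rw [q_ins_pos _ _ (by simp only; omega) (by simp only; omega), if_neg h0]
        simp only; omega

/-- There is a bijection Φ from 321-avoiding to 132-avoiding permutations of
{1,…,n} such that the excedance set of π equals the descent set of Φ(π). -/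
theorem stmt2 (n : ℕ) (hn : 1 ≤ n) :
    ∃ Φ : {π : Equiv.Perm (Fin n) // Avoids π pat321} ≃
            {σ : Equiv.Perm (Fin n) // Avoids σ pat132},
      ∀ π : {π : Equiv.Perm (Fin n) // Avoids π pat321},
        ExcSet (π : Equiv.Perm (Fin n)) = DesSet ((Φ π : Equiv.Perm (Fin n))) := by
  obtain ⟨Φ, h⟩ := main_ind n
  exact ⟨Φ, fun π => (h π).1⟩
end

section
/- For every n ≥ 1 and every subset S ⊆ {1,…,n−1}, the number of 321-avoiding permutations π of {1,…,n} whose excedance set equals S is equal to the number of 132-avoiding permutations σ of {1,…,n} whose descent set equals S. -/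
/-- The set of excedances of `π`: positions i with π(i) > i. -/
def ExcFinset {n : ℕ} (π : Equiv.Perm (Fin n)) : Finset (Fin n) :=
  Finset.univ.filter (fun i => i < π i)

/-- The set of descents of `π`: positions i with π(i) > π(i+1). -/
def DesFinset {n : ℕ} (π : Equiv.Perm (Fin n)) : Finset (Fin n) :=
  Finset.univ.filter (fun i => ∃ h : (i : ℕ) + 1 < n, π ⟨(i : ℕ) + 1, h⟩ < π i)


theorem avoids321_iff {n : ℕ} (π : Equiv.Perm (Fin n)) : Avoids π pat321 ↔
    ∀ a b c : Fin n, a < b → b < c → π c < π b → π b < π a → False := by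
  have e0 : pat321 0 = 2 := by decide
  have e1 : pat321 1 = 1 := by decide
  have e2 : pat321 2 = 0 := by decide
  constructor
  · intro h a b c hab hbc h1 h2
    apply h
    refine ⟨![a, b, c], ?_, ?_⟩
    · intro x y hxy
      fin_cases x <;> fin_cases y <;> simp at hxy ⊢ <;> order
    · intro x y
      fin_cases x <;> fin_cases y <;> simp [e0, e1, e2] <;> order
  · rintro h ⟨f, hf, hp⟩
    refine h (f 0) (f 1) (f 2) (hf _ _ (by decide)) (hf _ _ (by decide)) ?_ ?_
    · exact (hp 2 1).1 (by decide)
    · exact (hp 1 0).1 (by decide)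

theorem avoids132_iff {n : ℕ} (π : Equiv.Perm (Fin n)) : Avoids π pat132 ↔
    ∀ a b c : Fin n, a < b → b < c → π c < π b → π a < π c → False := by
  have e0 : pat132 0 = 0 := by decide
  have e1 : pat132 1 = 2 := by decide
  have e2 : pat132 2 = 1 := by decide
  constructor
  · intro h a b c hab hbc h1 h2
    apply h
    refine ⟨![a, b, c], ?_, ?_⟩
    · intro x y hxy
      fin_cases x <;> fin_cases y <;> simp at hxy ⊢ <;> order
    · intro x y
      fin_cases x <;> fin_cases y <;> simp [e0, e1, e2] <;> order
  · rintro h ⟨f, hf, hp⟩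
    refine h (f 0) (f 1) (f 2) (hf _ _ (by decide)) (hf _ _ (by decide)) ?_ ?_
    · exact (hp 2 1).1 (by decide)
    · exact (hp 0 2).1 (by decide)

/-- filling lemma -/
theorem fill {n : ℕ} (A : Finset (Fin n)) (f b : Fin n → Fin n) (hf : Set.InjOn f A)
    (hb : ∀ i, i ≤ b i) (h : ∀ i, i ∉ A → ∀ a ∈ A, f a ≤ b i → a < i) :
    ∃ π : Equiv.Perm (Fin n), (∀ a ∈ A, π a = f a) ∧
      (∀ i j, i ∉ A → j ∉ A → i < j → π i < π j) ∧ (∀ i, i ∉ A → π i ≤ b i) := by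
  classical
  set B := A.image f with hB
  have hcard : Bᶜ.card = Aᶜ.card := by
    rw [Finset.card_compl, Finset.card_compl, hB, Finset.card_image_of_injOn hf]
  let e : Fin n → Fin n := fun i =>
    if hi : i ∈ Aᶜ then (Bᶜ.orderIsoOfFin hcard ((Aᶜ.orderIsoOfFin rfl).symm ⟨i, hi⟩) : Fin n)
    else f i
  have e1 : ∀ a ∈ A, e a = f a := by
    intro a ha
    simp [e, ha]
  have e2 : ∀ i j, i ∉ A → j ∉ A → i < j → e i < e j := by
    intro i j hi hj hij
    simp only [e, Finset.mem_compl, hi, hj, not_false_eq_true, dif_pos]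
    simpa using hij
  have e3 : ∀ i, i ∉ A → e i ∉ B := by
    intro i hi
    simp only [e, Finset.mem_compl, hi, not_false_eq_true, dif_pos]
    exact Finset.mem_compl.1
      (Bᶜ.orderIsoOfFin hcard ((Aᶜ.orderIsoOfFin rfl).symm ⟨i, by simpa using hi⟩)).2
  have inj : Function.Injective e := by
    intro i j hij
    by_cases hi : i ∈ A <;> by_cases hj : j ∈ A
    · exact hf hi hj (by rw [← e1 i hi, ← e1 j hj, hij])
    · exact absurd (by rw [← hij, e1 i hi]; exact Finset.mem_image_of_mem _ hi) (e3 j hj)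
    · exact absurd (by rw [hij, e1 j hj]; exact Finset.mem_image_of_mem _ hj) (e3 i hi)
    · rcases lt_trichotomy i j with h | h | h
      · exact absurd hij (e2 i j hi hj h).ne
      · exact h
      · exact absurd hij (e2 j i hj hi h).ne'
  have hbij := Finite.injective_iff_bijective.1 inj
  refine ⟨Equiv.ofBijective e hbij, e1, e2, ?_⟩
  intro i hi
  by_contra hlt
  simp only [Equiv.ofBijective_apply, not_le] at hlt
  have hsub : Finset.Iic (b i) ⊆ (Finset.Iio i).image e := by
    intro v hv
    rw [Finset.mem_Iic] at hv
    obtain ⟨j, rfl⟩ := hbij.2 v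
    refine Finset.mem_image_of_mem _ (Finset.mem_Iio.2 ?_)
    by_cases hj : j ∈ A
    · exact h i hi j hj (by rwa [← e1 j hj])
    · by_contra hji
      rcases (not_lt.1 hji).lt_or_eq with h' | h'
      · have := e2 i j hi hj h'
        order
      · subst h'; order
  have := (Finset.card_le_card hsub).trans Finset.card_image_le
  rw [Fin.card_Iic, Fin.card_Iio] at this
  have := Fin.le_def.1 (hb i)
  omega

/-- Two permutations agreeing up to a tie-breaking rule -/
theorem perm_ext_aux {n : ℕ} (π τ : Equiv.Perm (Fin n))
    (h : ∀ i, (∀ j < i, π j = τ j) → ¬ (π i < τ i) ∧ ¬ (τ i < π i)) : π = τ := by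
  ext1 i
  induction i using WellFoundedLT.induction with
  | ind i ih =>
    obtain ⟨h1, h2⟩ := h i ih
    order

def Asc {m : ℕ} (M : Fin (m+1) → Fin (m+1)) : Finset (Fin (m+1)) :=
  Finset.univ.filter (fun i => ∃ h : (i : ℕ) + 1 < m + 1, M i < M ⟨(i : ℕ) + 1, h⟩)

theorem mem_Asc {m : ℕ} {M : Fin (m+1) → Fin (m+1)} {i} :
    i ∈ Asc M ↔ ∃ h : (i : ℕ) + 1 < m + 1, M i < M ⟨(i : ℕ) + 1, h⟩ := by
  simp [Asc]

open Classical in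
noncomputable def DS {m : ℕ} (S : Finset (Fin (m+1))) : Finset (Fin (m+1) → Fin (m+1)) :=
  Finset.univ.filter (fun M => (∀ i j, i ≤ j → M i ≤ M j) ∧ (∀ i, i ≤ M i) ∧ Asc M = S)

noncomputable def PM {m : ℕ} (τ : Equiv.Perm (Fin (m+1))) (i : Fin (m+1)) : Fin (m+1) :=
  (Finset.Iic i).sup τ

theorem le_PM {m : ℕ} (τ : Equiv.Perm (Fin (m+1))) {i j : Fin (m+1)} (h : j ≤ i) :
    τ j ≤ PM τ i := Finset.le_sup (f := τ) (Finset.mem_Iic.2 h)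

theorem PM_le {m : ℕ} (τ : Equiv.Perm (Fin (m+1))) {i v : Fin (m+1)}
    (h : ∀ j ≤ i, τ j ≤ v) : PM τ i ≤ v :=
  Finset.sup_le (fun j hj => h j (Finset.mem_Iic.1 hj))

theorem PM_att {m : ℕ} (τ : Equiv.Perm (Fin (m+1))) (i : Fin (m+1)) :
    ∃ j ≤ i, τ j = PM τ i := by
  obtain ⟨j, hj, h⟩ := Finset.exists_mem_eq_sup (Finset.Iic i) ⟨i, by simp⟩ τ
  exact ⟨j, Finset.mem_Iic.1 hj, h.symm⟩

theorem PM_mono {m : ℕ} (τ : Equiv.Perm (Fin (m+1))) {i j : Fin (m+1)} (h : i ≤ j) :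
    PM τ i ≤ PM τ j := PM_le τ (fun _ hk => le_PM τ (hk.trans h))

theorem PM_ge {m : ℕ} (τ : Equiv.Perm (Fin (m+1))) (i : Fin (m+1)) : i ≤ PM τ i := by
  have : (Finset.Iic i).image τ ⊆ Finset.Iic (PM τ i) := by
    intro v hv
    obtain ⟨j, hj, rfl⟩ := Finset.mem_image.1 hv
    exact Finset.mem_Iic.2 (le_PM τ (Finset.mem_Iic.1 hj))
  have := Finset.card_le_card this
  rw [Finset.card_image_of_injective _ τ.injective, Fin.card_Iic, Fin.card_Iic] at this
  rw [Fin.le_def]; omega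

def Av312 {n : ℕ} (τ : Equiv.Perm (Fin n)) : Prop :=
  ∀ a b c : Fin n, a < b → b < c → τ b < τ c → τ c < τ a → False

theorem Asc_PM {m : ℕ} (τ : Equiv.Perm (Fin (m+1))) (h : Av312 τ) : Asc (PM τ) = Asc τ := by
  ext i
  rw [mem_Asc, mem_Asc]
  refine exists_congr fun hi => ?_
  set i' : Fin (m+1) := ⟨i + 1, hi⟩ with hi'
  have hlt : i < i' := by simp [hi', Fin.lt_def]
  constructor
  · intro hl
    obtain ⟨j, hj, hjv⟩ := PM_att τ i'
    have : j = i' := by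
      by_contra hne
      have : j ≤ i := by
        rw [Fin.le_def] at *
        have : (j : ℕ) ≠ i + 1 := fun h => hne (Fin.ext h)
        simp only [hi'] at hj
        omega
      have := le_PM τ this
      order
    subst this
    have := le_PM τ (le_refl i)
    order
  · intro hl
    have h2 := le_PM τ (le_refl i')
    obtain ⟨j, hj, hjv⟩ := PM_att τ i
    by_contra hcon
    have h3 : τ i' ≤ τ j := by order
    have hne : τ i' ≠ τ j := fun he => by
      have := τ.injective he
      order
    have hne2 : j ≠ i := by rintro rfl; order
    exact h j i i' (by order) hlt hl (by order)

theorem PM_inj {m : ℕ} (τ τ' : Equiv.Perm (Fin (m+1))) (h : Av312 τ) (h' : Av312 τ')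
    (he : PM τ = PM τ') : τ = τ' := by
  have key : ∀ (τ τ' : Equiv.Perm (Fin (m+1))), Av312 τ → PM τ = PM τ' → ∀ i,
      (∀ j < i, τ j = τ' j) → ¬ τ i < τ' i := by
    intro τ τ' h he i ih hlt
    obtain ⟨a, ha, hav⟩ := PM_att τ i
    have h1 : τ' i ≤ τ a := by rw [hav, he]; exact le_PM τ' le_rfl
    have hai : a ≠ i := by rintro rfl; order
    have hai' : a < i := by order
    have h2 : τ' i ≠ τ a := by
      rw [ih a hai']; intro hh; exact hai (τ'.injective hh).symm
    obtain ⟨c, hc⟩ := τ.surjective (τ' i)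
    have hci : i < c := by
      by_contra hcon
      rcases (not_lt.1 hcon).lt_or_eq with hh | hh
      · rw [ih c hh] at hc
        have := τ'.injective hc
        order
      · subst hh; order
    exact h a i c hai' hci (by order) (by order)
  exact perm_ext_aux τ τ' fun i hi =>
    ⟨key τ τ' h he i hi, key τ' τ h' he.symm i (fun j hj => (hi j hj).symm)⟩

theorem PM_swap {m : ℕ} (τ : Equiv.Perm (Fin (m+1))) (a b c : Fin (m+1)) (hab : a < b)
    (hbc : b < c) (hba : τ b < τ a) (hca : τ c < τ a) : PM (τ * Equiv.swap b c) ≤ PM τ := by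
  intro i
  apply PM_le
  intro j hj
  rw [Equiv.Perm.mul_apply]
  by_cases h1 : j = b
  · subst h1
    rw [Equiv.swap_apply_left]
    have := le_PM τ (show a ≤ i by order)
    order
  by_cases h2 : j = c
  · subst h2
    rw [Equiv.swap_apply_right]
    exact le_PM τ (by order)
  rw [Equiv.swap_apply_of_ne_of_ne h1 h2]
  exact le_PM τ hj

theorem exists_av312 {m : ℕ} (τ₀ : Equiv.Perm (Fin (m+1))) :
    ∃ τ : Equiv.Perm (Fin (m+1)), Av312 τ ∧ PM τ = PM τ₀ := by
  classical
  obtain ⟨τ, hτ, hmin⟩ := Finset.exists_min_image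
    (Finset.univ.filter (fun τ : Equiv.Perm (Fin (m+1)) => PM τ = PM τ₀))
    (fun τ => ∑ i : Fin (m+1), ((i : ℕ) : ℤ) * ((τ i : ℕ) : ℤ)) ⟨τ₀, by simp⟩
  rw [Finset.mem_filter] at hτ
  refine ⟨τ, ?_, hτ.2⟩
  intro a b c hab hbc h1 h2
  have hac : a < c := by order
  have hPM : PM (τ * Equiv.swap b c) = PM τ := by
    apply le_antisymm (PM_swap τ a b c hab hbc (by order) h2)
    have hswap : (τ * Equiv.swap b c) * Equiv.swap b c = τ := by
      rw [mul_assoc, Equiv.swap_mul_self, mul_one]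
    conv_lhs => rw [← hswap]
    apply PM_swap _ a b c hab hbc
    · simp only [Equiv.Perm.mul_apply, Equiv.swap_apply_left]
      rw [Equiv.swap_apply_of_ne_of_ne hab.ne hac.ne]; exact h2
    · simp only [Equiv.Perm.mul_apply, Equiv.swap_apply_right]
      rw [Equiv.swap_apply_of_ne_of_ne hab.ne hac.ne]; order
  have := hmin (τ * Equiv.swap b c) (by simp [hPM, hτ.2])
  have hbc' : b ≠ c := hbc.ne
  have hs : ∀ σ : Equiv.Perm (Fin (m+1)), ∑ i : Fin (m+1), ((i : ℕ) : ℤ) * ((σ i : ℕ) : ℤ) =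
      ((b : ℕ) : ℤ) * ((σ b : ℕ) : ℤ) + (((c : ℕ) : ℤ) * ((σ c : ℕ) : ℤ) +
      ∑ i ∈ (Finset.univ.erase b).erase c, ((i : ℕ) : ℤ) * ((σ i : ℕ) : ℤ)) := by
    intro σ
    rw [Finset.add_sum_erase _ (fun i : Fin (m+1) => ((i : ℕ) : ℤ) * ((σ i : ℕ) : ℤ)) (by simp [hbc'.symm]),
      Finset.add_sum_erase _ (fun i : Fin (m+1) => ((i : ℕ) : ℤ) * ((σ i : ℕ) : ℤ)) (by simp)]
  rw [hs, hs] at this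
  have hrest : ∑ i ∈ (Finset.univ.erase b).erase c,
      ((i : ℕ) : ℤ) * (((τ * Equiv.swap b c) i : ℕ) : ℤ) =
      ∑ i ∈ (Finset.univ.erase b).erase c, ((i : ℕ) : ℤ) * ((τ i : ℕ) : ℤ) := by
    apply Finset.sum_congr rfl
    intro i hi
    simp only [Finset.mem_erase] at hi
    rw [Equiv.Perm.mul_apply, Equiv.swap_apply_of_ne_of_ne hi.2.1 hi.1]
  rw [hrest, Equiv.Perm.mul_apply, Equiv.Perm.mul_apply, Equiv.swap_apply_left,
    Equiv.swap_apply_right] at this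
  have q1 : ((b : ℕ) : ℤ) < ((c : ℕ) : ℤ) := by exact_mod_cast hbc
  have q2 : ((τ b : ℕ) : ℤ) < ((τ c : ℕ) : ℤ) := by exact_mod_cast h1
  nlinarith

theorem Asc_lt {m : ℕ} {M : Fin (m+1) → Fin (m+1)} (hM : ∀ i j, i ≤ j → M i ≤ M j)
    {s j : Fin (m+1)} (hs : s ∈ Asc M) (h : s < j) : M s < M j := by
  obtain ⟨h1, h2⟩ := mem_Asc.1 hs
  exact h2.trans_le (hM _ _ (by rw [Fin.le_def]; exact h))

theorem exists_PM {m : ℕ} (M : Fin (m+1) → Fin (m+1)) (hM : ∀ i j, i ≤ j → M i ≤ M j)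
    (hM2 : ∀ i, i ≤ M i) : ∃ τ : Equiv.Perm (Fin (m+1)), PM τ = M := by
  classical
  set A : Finset (Fin (m+1)) := Finset.univ.filter (fun p => ∀ j < p, M j < M p) with hA
  have hmem : ∀ p, p ∈ A ↔ ∀ j < p, M j < M p := by simp [hA]
  obtain ⟨τ, h1, -, h3⟩ := fill A M M (by
      intro p hp q hq hpq
      rcases lt_trichotomy p q with h | h | h
      · exact absurd hpq ((hmem q).1 hq p h).ne
      · exact h
      · exact absurd hpq ((hmem p).1 hp q h).ne') hM2 (by
      intro i hi a ha hle
      by_contra hcon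
      rcases (not_lt.1 hcon).lt_or_eq with h | h
      · have := (hmem a).1 ha i h
        order
      · subst h; exact hi ha)
  refine ⟨τ, funext fun i => le_antisymm ?_ ?_⟩
  · apply PM_le
    intro j hj
    by_cases hjA : j ∈ A
    · rw [h1 j hjA]; exact hM _ _ hj
    · exact (h3 j hjA).trans (hM _ _ hj)
  · induction i using WellFoundedLT.induction with
    | ind i ih =>
      by_cases hi : i ∈ A
      · rw [← h1 i hi]; exact le_PM τ le_rfl
      · rw [hmem] at hi
        push Not at hi
        obtain ⟨j, hj, hle⟩ := hi
        exact hle.trans ((ih j hj).trans (PM_mono τ hj.le))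

theorem card312 {m : ℕ} (S : Finset (Fin (m+1))) : 
    (Finset.univ.filter (fun σ : Equiv.Perm (Fin (m+1)) => Avoids σ pat132 ∧ DesFinset σ = S)).card
      = (DS S).card := by
  classical
  have hav : ∀ σ : Equiv.Perm (Fin (m+1)), Avoids σ pat132 ↔ Av312 (Fin.revPerm * σ) := by
    intro σ
    rw [avoids132_iff]
    simp [Av312]
  have hdes : ∀ σ : Equiv.Perm (Fin (m+1)), DesFinset σ = Asc (Fin.revPerm * σ : Equiv.Perm _) := by
    intro σ
    simp [DesFinset, Asc]
  refine Finset.card_bij (fun σ _ => PM (Fin.revPerm * σ)) ?_ ?_ ?_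
  · intro σ hσ
    simp only [Finset.mem_filter, Finset.mem_univ, true_and, hav, hdes] at hσ
    simp only [DS, Finset.mem_filter, Finset.mem_univ, true_and]
    exact ⟨fun i j h => PM_mono _ h, PM_ge _, by rw [Asc_PM _ hσ.1, hσ.2]⟩
  · intro σ hσ σ' hσ' he
    simp only [Finset.mem_filter, Finset.mem_univ, true_and, hav, hdes] at hσ hσ'
    exact mul_left_cancel (PM_inj _ _ hσ.1 hσ'.1 he)
  · intro M hM
    simp only [DS, Finset.mem_filter, Finset.mem_univ, true_and] at hM
    obtain ⟨τ₀, h0⟩ := exists_PM M hM.1 hM.2.1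
    obtain ⟨τ, h1, h2⟩ := exists_av312 τ₀
    have e : Fin.revPerm * (Fin.revPerm⁻¹ * τ) = τ := by group
    refine ⟨Fin.revPerm⁻¹ * τ, ?_, by rw [e, h2, h0]⟩
    simp only [Finset.mem_filter, Finset.mem_univ, true_and, hav, hdes]
    rw [e]
    exact ⟨h1, by rw [← Asc_PM _ h1, h2, h0, hM.2.2]⟩

noncomputable def NM {m : ℕ} (π : Equiv.Perm (Fin (m+1))) (i : Fin (m+1)) : Fin (m+1) :=
  (Finset.univ.filter (fun j => i ≤ j ∧ j < π j)).inf
    (fun j => (⟨(π j : ℕ) - 1, by omega⟩ : Fin (m+1)))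

theorem NM_le {m : ℕ} (π : Equiv.Perm (Fin (m+1))) {i j : Fin (m+1)} (h : i ≤ j) (hj : j < π j) :
    (NM π i : ℕ) + 1 ≤ π j := by
  have h1 : NM π i ≤ (⟨(π j : ℕ) - 1, by omega⟩ : Fin (m+1)) :=
    Finset.inf_le (f := fun j => (⟨(π j : ℕ) - 1, by omega⟩ : Fin (m+1))) (by simp [h, hj])
  rw [Fin.le_def] at h1
  rw [Fin.lt_def] at hj
  simp only at h1
  omega

theorem le_NM {m : ℕ} (π : Equiv.Perm (Fin (m+1))) {i v : Fin (m+1)}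
    (h : ∀ j, i ≤ j → j < π j → v < π j) : v ≤ NM π i := by
  apply Finset.le_inf
  intro j hj
  simp only [Finset.mem_filter, Finset.mem_univ, true_and] at hj
  have := h j hj.1 hj.2
  rw [Fin.lt_def] at this
  rw [Fin.le_def]
  simp only
  omega

theorem NM_mono {m : ℕ} (π : Equiv.Perm (Fin (m+1))) {i j : Fin (m+1)} (h : i ≤ j) :
    NM π i ≤ NM π j := by
  apply le_NM
  intro k hk hk2
  have := NM_le π (h.trans hk) hk2
  rw [Fin.lt_def]; omega

theorem NM_ge {m : ℕ} (π : Equiv.Perm (Fin (m+1))) (i : Fin (m+1)) : i ≤ NM π i :=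
  le_NM π fun j h1 h2 => by order

theorem exc_mono {n : ℕ} (π : Equiv.Perm (Fin n))
    (h : ∀ a b c : Fin n, a < b → b < c → π c < π b → π b < π a → False)
    {i j : Fin n} (hi : i < π i) (hj : j < π j) (hij : i < j) : π i < π j := by
  classical
  by_contra hcon
  have hne : π i ≠ π j := fun h => hij.ne (π.injective h)
  have hlt : π j < π i := by order
  have hsub : (Finset.Iio (π j)) ⊆ ((Finset.Iio j).erase i).image π := by
    intro v hv
    rw [Finset.mem_Iio] at hv
    obtain ⟨k, rfl⟩ := π.surjective v
    apply Finset.mem_image_of_mem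
    rw [Finset.mem_erase, Finset.mem_Iio]
    refine ⟨by rintro rfl; order, ?_⟩
    by_contra hk
    rcases (not_lt.1 hk).lt_or_eq with h' | h'
    · exact h i j k hij h' hv hlt
    · subst h'; order
  have h1 := (Finset.card_le_card hsub).trans Finset.card_image_le
  rw [Finset.card_erase_of_mem (Finset.mem_Iio.2 hij), Fin.card_Iio, Fin.card_Iio] at h1
  rw [Fin.lt_def] at hj hij
  omega

theorem nexc_mono {n : ℕ} (π : Equiv.Perm (Fin n))
    (h : ∀ a b c : Fin n, a < b → b < c → π c < π b → π b < π a → False)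
    {i j : Fin n} (hi : ¬ i < π i) (hj : ¬ j < π j) (hij : i < j) : π i < π j := by
  classical
  by_contra hcon
  have hne : π i ≠ π j := fun h => hij.ne (π.injective h)
  have hlt : π j < π i := by order
  have hsub : (Finset.Iio i).image π ⊆ (Finset.Iio (π i)).erase (π j) := by
    intro v hv
    obtain ⟨k, hk, rfl⟩ := Finset.mem_image.1 hv
    rw [Finset.mem_Iio] at hk
    rw [Finset.mem_erase, Finset.mem_Iio]
    refine ⟨fun he => by have := π.injective he; order, ?_⟩
    by_contra hk2
    have hne : π k ≠ π i := fun he => hk.ne (π.injective he)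
    exact h k i j hk hij hlt (by order)
  have h1 := Finset.card_le_card hsub
  rw [Finset.card_image_of_injective _ π.injective,
    Finset.card_erase_of_mem (Finset.mem_Iio.2 hlt), Fin.card_Iio, Fin.card_Iio] at h1
  rw [Fin.lt_def] at hi hlt
  omega

theorem NM_exc {m : ℕ} (π : Equiv.Perm (Fin (m+1)))
    (h : ∀ a b c : Fin (m+1), a < b → b < c → π c < π b → π b < π a → False)
    {i : Fin (m+1)} (hi : i < π i) : (NM π i : ℕ) + 1 = π i := by
  apply le_antisymm (NM_le π le_rfl hi)
  have : (⟨(π i : ℕ) - 1, by omega⟩ : Fin (m+1)) ≤ NM π i := by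
    apply le_NM
    intro j hij hj
    rw [Fin.lt_def] at hi hj
    have : π i ≤ π j := by
      rcases hij.lt_or_eq with h' | h'
      · exact (exc_mono π h hi hj h').le
      · rw [h']
    rw [Fin.le_def] at this
    rw [Fin.lt_def]; simp only; omega
  rw [Fin.le_def] at this
  simp only at this
  omega

theorem Asc_NM {m : ℕ} (π : Equiv.Perm (Fin (m+1)))
    (h : ∀ a b c : Fin (m+1), a < b → b < c → π c < π b → π b < π a → False) :
    Asc (NM π) = ExcFinset π := by
  ext i
  rw [mem_Asc]
  simp only [ExcFinset, Finset.mem_filter, Finset.mem_univ, true_and]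
  constructor
  · rintro ⟨hi, hlt⟩
    by_contra hcon
    have : NM π ⟨(i : ℕ) + 1, hi⟩ ≤ NM π i := by
      apply le_NM
      intro j hij hj
      have hne : i ≠ j := by rintro rfl; exact hcon hj
      have := NM_le π (i := ⟨(i : ℕ) + 1, hi⟩) (j := j)
        (by rw [Fin.le_def] at *; have : (i : ℕ) ≠ j := fun e => hne (Fin.ext e)
            simp only; omega) hj
      rw [Fin.lt_def]; omega
    order
  · intro hi
    have h0 := hi
    rw [Fin.lt_def] at h0
    have h1 : (i : ℕ) + 1 < m + 1 := by have := (π i).2; omega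
    refine ⟨h1, ?_⟩
    have h2 := NM_exc π h hi
    have h3 : π i ≤ NM π ⟨(i : ℕ) + 1, h1⟩ := by
      apply le_NM
      intro j hij hj
      exact exc_mono π h hi hj (by rw [Fin.le_def] at hij; rw [Fin.lt_def]; exact hij)
    rw [Fin.le_def] at h3
    rw [Fin.lt_def]; omega

theorem NM_inj {m : ℕ} (π π' : Equiv.Perm (Fin (m+1)))
    (h : ∀ a b c : Fin (m+1), a < b → b < c → π c < π b → π b < π a → False)
    (h' : ∀ a b c : Fin (m+1), a < b → b < c → π' c < π' b → π' b < π' a → False)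
    (he : NM π = NM π') : π = π' := by
  have hexc : ∀ i, i < π i ↔ i < π' i := by
    intro i
    have h1 : i ∈ ExcFinset π ↔ i ∈ ExcFinset π' := by
      rw [← Asc_NM π h, ← Asc_NM π' h', he]
    simpa [ExcFinset] using h1
  have hval : ∀ i, i < π i → π i = π' i := by
    intro i hi
    have h1 := NM_exc π h hi
    have h2 := NM_exc π' h' ((hexc i).1 hi)
    rw [he] at h1
    exact Fin.ext (by omega)
  have key : ∀ (π π' : Equiv.Perm (Fin (m+1))),
      (∀ a b c : Fin (m+1), a < b → b < c → π' c < π' b → π' b < π' a → False) →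
      (∀ i, i < π i ↔ i < π' i) → (∀ i, i < π i → π i = π' i) → ∀ i,
      (∀ j < i, π j = π' j) → ¬ π i < π' i := by
    intro π π' h' hexc hval i ih hlt
    obtain ⟨c, hc⟩ := π'.surjective (π i)
    have hi : ¬ i < π i := fun hi => by have := hval i hi; order
    have hic : i < c := by
      by_contra hcon
      rcases (not_lt.1 hcon).lt_or_eq with hh | hh
      · rw [← ih c hh] at hc
        have := π.injective hc
        order
      · subst hh; order
    have hcx : ¬ c < π' c := fun hcx => by
      have := hval c ((hexc c).2 hcx)
      rw [← this] at hc
      have := π.injective hc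
      order
    have := nexc_mono π' h' (fun hh => hi ((hexc i).2 hh)) hcx hic
    order
  exact perm_ext_aux π π' fun i hi =>
    ⟨key π π' h' hexc hval i hi, key π' π h (fun i => (hexc i).symm)
      (fun i hi => (hval i ((hexc i).2 hi)).symm) i (fun j hj => (hi j hj).symm)⟩

theorem exists_NM {m : ℕ} (M : Fin (m+1) → Fin (m+1)) (hM : ∀ i j, i ≤ j → M i ≤ M j)
    (hM2 : ∀ i, i ≤ M i) : ∃ π : Equiv.Perm (Fin (m+1)),
      (∀ a b c : Fin (m+1), a < b → b < c → π c < π b → π b < π a → False) ∧ NM π = M := by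
  classical
  have hf : ∀ s ∈ Asc M, ((M s + 1 : Fin (m+1)) : ℕ) = (M s : ℕ) + 1 := by
    intro s hs
    obtain ⟨h1, h2⟩ := mem_Asc.1 hs
    exact Fin.val_add_one_of_lt (h2.trans_le (Fin.le_last _))
  obtain ⟨π, h1, h2, h3⟩ := fill (Asc M) (fun s => M s + 1) id (by
      intro p hp q hq hpq
      have hpq' : M p = M q := by simpa using hpq
      rcases lt_trichotomy p q with h | h | h
      · exact absurd hpq' (Asc_lt hM hp h).ne
      · exact h
      · exact absurd hpq' (Asc_lt hM hq h).ne') (fun i => le_rfl) (by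
      intro i hi a ha hle
      have e1 := hf a ha
      have e2 := hM2 a
      simp only [id] at hle
      rw [Fin.le_def] at hle e2
      rw [Fin.lt_def]
      omega)
  have hv : ∀ s ∈ Asc M, (π s : ℕ) = (M s : ℕ) + 1 := by
    intro s hs
    rw [h1 s hs]; exact hf s hs
  have hexc : ∀ i, i < π i ↔ i ∈ Asc M := by
    intro i
    constructor
    · intro hi
      by_contra hcon
      have := h3 i hcon
      simp only [id] at this
      order
    · intro hi
      have e1 := hv i hi
      have e2 := hM2 i
      rw [Fin.le_def] at e2
      rw [Fin.lt_def]; omega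
  have hmono : ∀ i j, i ∈ Asc M → j ∈ Asc M → i < j → π i < π j := by
    intro i j hi hj hij
    have e1 := hv i hi
    have e2 := hv j hj
    have e3 := Asc_lt hM hi hij
    rw [Fin.lt_def] at e3 ⊢
    omega
  refine ⟨π, ?_, ?_⟩
  · intro a b c hab hbc hcb hba
    have hac : a < c := hab.trans hbc
    have hca : π c < π a := hcb.trans hba
    by_cases ha : a ∈ Asc M <;> by_cases hb : b ∈ Asc M <;> by_cases hc : c ∈ Asc M
    · exact (hmono a b ha hb hab).not_gt hba
    · exact (hmono a b ha hb hab).not_gt hba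
    · exact (hmono a c ha hc hac).not_gt hca
    · exact (h2 b c hb hc hbc).not_gt hcb
    · exact (hmono b c hb hc hbc).not_gt hcb
    · exact (h2 a c ha hc hac).not_gt hca
    · exact (h2 a b ha hb hab).not_gt hba
    · exact (h2 a b ha hb hab).not_gt hba
  · funext i
    apply le_antisymm
    · obtain ⟨j, hj, hmax⟩ := Finset.exists_max_image
        (Finset.univ.filter (fun j => M j = M i)) id ⟨i, by simp⟩
      simp only [Finset.mem_filter, Finset.mem_univ, true_and, id] at hj hmax
      have hij := hmax i rfl
      by_cases hjm : (j : ℕ) + 1 < m + 1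
      · have hjA : j ∈ Asc M := by
          refine mem_Asc.2 ⟨hjm, ?_⟩
          have hle : M j ≤ M ⟨(j : ℕ) + 1, hjm⟩ := hM _ _ (by rw [Fin.le_def]; simp)
          refine lt_of_le_of_ne hle fun he => ?_
          have := hmax ⟨(j : ℕ) + 1, hjm⟩ (by rw [← he, hj])
          rw [Fin.le_def] at this
          simp only at this
          omega
        have e1 := NM_le π hij ((hexc j).2 hjA)
        have e2 := hv j hjA
        rw [hj] at e2
        rw [Fin.le_def]; omega
      · have := hM2 j
        rw [hj] at this
        rw [Fin.le_def] at this ⊢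
        have := (NM π i).2
        omega
    · apply le_NM
      intro j hij hj
      have e1 := hv j ((hexc j).1 hj)
      have e2 := hM i j hij
      rw [Fin.le_def] at e2
      rw [Fin.lt_def]; omega

theorem card321 {m : ℕ} (S : Finset (Fin (m+1))) :
    (Finset.univ.filter (fun π : Equiv.Perm (Fin (m+1)) => Avoids π pat321 ∧ ExcFinset π = S)).card
      = (DS S).card := by
  classical
  refine Finset.card_bij (fun π _ => NM π) ?_ ?_ ?_
  · intro π hπ
    simp only [Finset.mem_filter, Finset.mem_univ, true_and, avoids321_iff] at hπ
    simp only [DS, Finset.mem_filter, Finset.mem_univ, true_and]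
    exact ⟨fun i j h => NM_mono _ h, NM_ge _, by rw [Asc_NM _ hπ.1, hπ.2]⟩
  · intro π hπ π' hπ' he
    simp only [Finset.mem_filter, Finset.mem_univ, true_and, avoids321_iff] at hπ hπ'
    exact NM_inj _ _ hπ.1 hπ'.1 he
  · intro M hM
    simp only [DS, Finset.mem_filter, Finset.mem_univ, true_and] at hM
    obtain ⟨π, h1, h2⟩ := exists_NM M hM.1 hM.2.1
    refine ⟨π, ?_, h2⟩
    simp only [Finset.mem_filter, Finset.mem_univ, true_and, avoids321_iff]
    exact ⟨h1, by rw [← Asc_NM π h1, h2, hM.2.2]⟩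

/-- For every subset S of {1,…,n−1}, the number of 321-avoiding permutations
with excedance set S equals the number of 132-avoiding permutations with
descent set S. -/
theorem stmt3 (n : ℕ) (hn : 1 ≤ n) (S : Finset (Fin n))
    (hS : ∀ i ∈ S, (i : ℕ) + 1 < n) :
    (Finset.univ.filter
      (fun π : Equiv.Perm (Fin n) => Avoids π pat321 ∧ ExcFinset π = S)).card =
    (Finset.univ.filter
      (fun σ : Equiv.Perm (Fin n) => Avoids σ pat132 ∧ DesFinset σ = S)).card := by
  obtain ⟨m, rfl⟩ : ∃ m, n = m + 1 := ⟨n - 1, by omega⟩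
  rw [card321, card312]
end

section
/- For every n ≥ 1 and every k with 0 ≤ k ≤ n−1, the number of 132-avoiding permutations of {1,…,n} with exactly k descents equals the Narayana number N(n,k+1) = (1/n)·C(n,k)·C(n,k+1). -/
lemma nar_avoids_iff {n : ℕ} (π : Equiv.Perm (Fin n)) :
    Avoids π pat132 ↔ ∀ i j k : Fin n, i < j → j < k → π i < π k → π k < π j → False := by
  unfold Avoids Contains
  constructor
  · intro h i j k hij hjk h1 h2
    apply h
    refine ⟨![i, j, k], ?_, ?_⟩
    · intro a b hab
      fin_cases a <;> fin_cases b <;> simp_all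
      exact hij.trans hjk
    · intro a b
      have h3 := h1.trans h2
      fin_cases a <;> fin_cases b <;>
        simp [pat132, Equiv.swap_apply_def, h1, h2, h3, h1.le, h2.le, h3.le]
  · rintro h ⟨f, hf, hp⟩
    refine h (f 0) (f 1) (f 2) (hf _ _ (by decide)) (hf _ _ (by decide)) ?_ ?_
    · rw [← hp]; decide
    · rw [← hp]; decide

/-- Insert value `v` at the front. -/
def narIns {n : ℕ} (v : Fin (n+1)) (σ : Equiv.Perm (Fin n)) : Equiv.Perm (Fin (n+1)) :=
  ((finSuccEquiv' 0).trans (Equiv.optionCongr σ)).trans (finSuccEquiv' v).symm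

@[simp] lemma narIns_zero {n : ℕ} (v : Fin (n+1)) (σ : Equiv.Perm (Fin n)) :
    narIns v σ 0 = v := by
  simp [narIns]

@[simp] lemma narIns_succ {n : ℕ} (v : Fin (n+1)) (σ : Equiv.Perm (Fin n)) (i : Fin n) :
    narIns v σ i.succ = v.succAbove (σ i) := by
  have : (finSuccEquiv' (0 : Fin (n+1))) i.succ = some i := by
    rw [← Fin.succAbove_zero_apply, finSuccEquiv'_succAbove]
  simp [narIns, this]

lemma narIns_inj {n : ℕ} : Function.Injective
    (fun x : Fin (n+1) × Equiv.Perm (Fin n) => narIns x.1 x.2) := by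
  rintro ⟨v, σ⟩ ⟨w, ρ⟩ h
  simp only at h
  have h0 : v = w := by
    have := congrArg (fun e => e 0) h
    simpa using this
  subst h0
  have : σ = ρ := by
    ext i
    have := congrArg (fun e => e i.succ) h
    simp only [narIns_succ] at this
    rw [Fin.succAbove_right_injective this]
  rw [this]

lemma narIns_surj {n : ℕ} (π : Equiv.Perm (Fin (n+1))) : ∃ σ, narIns (π 0) σ = π := by
  have hb := (Fintype.bijective_iff_injective_and_card
    (fun x : Fin (n+1) × Equiv.Perm (Fin n) => narIns x.1 x.2)).2
      ⟨narIns_inj, by simp [Fintype.card_perm, Nat.factorial_succ]⟩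
  obtain ⟨⟨v, σ⟩, h⟩ := hb.2 π
  simp only at h
  refine ⟨σ, ?_⟩
  rw [← h]; simp

lemma nar_avoids_ins {m : ℕ} (v : Fin (m+2)) (σ : Equiv.Perm (Fin (m+1))) :
    Avoids (narIns v σ) pat132 ↔ Avoids σ pat132 ∧ (σ 0 : ℕ) ≤ v := by
  rw [nar_avoids_iff, nar_avoids_iff]
  have mono : ∀ a b : Fin (m+1), v.succAbove a < v.succAbove b ↔ a < b := fun a b =>
    Fin.succAbove_lt_succAbove_iff
  have hlt : ∀ a : Fin (m+1), v < v.succAbove a ↔ (v : ℕ) ≤ a := by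
    intro a
    rw [Fin.lt_succAbove_iff_le_castSucc, Fin.le_def, Fin.val_castSucc]
  constructor
  · intro h
    refine ⟨?_, ?_⟩
    · intro i j k hij hjk h1 h2
      refine h i.succ j.succ k.succ (by simpa using hij) (by simpa using hjk) ?_ ?_
      · simpa [mono] using h1
      · simpa [mono] using h2
    · by_contra hc
      push Not at hc
      have hv : (v : ℕ) < m + 1 := hc.trans (σ 0).isLt
      set w : Fin (m+1) := ⟨v, hv⟩ with hw
      have hwlt : w < σ 0 := hc
      have hj : (0 : Fin (m+1)) < σ.symm w := by
        rw [Fin.pos_iff_ne_zero]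
        intro h0
        have : w = σ 0 := by rw [← h0]; simp
        exact absurd this hwlt.ne
      refine h 0 (Fin.succ 0) (σ.symm w).succ (Fin.succ_pos _) (Fin.succ_lt_succ_iff.2 hj) ?_ ?_
      · rw [narIns_zero, narIns_succ, hlt]; simp [hw]
      · rw [narIns_succ, narIns_succ, mono]; simpa using hwlt
  · rintro ⟨h, h0⟩ i j k hij hjk h1 h2
    obtain ⟨j, rfl⟩ := Fin.exists_succ_eq.2 (Fin.pos_iff_ne_zero.1 ((Fin.zero_le i).trans_lt hij))
    obtain ⟨k, rfl⟩ := Fin.exists_succ_eq.2 (Fin.pos_iff_ne_zero.1 ((Fin.zero_le _).trans_lt hjk))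
    rw [Fin.succ_lt_succ_iff] at hjk
    rw [narIns_succ, narIns_succ, mono] at h2
    rcases Fin.eq_zero_or_eq_succ i with rfl | ⟨i, rfl⟩
    · rw [narIns_zero, narIns_succ, hlt] at h1
      have hk : σ 0 ≤ σ k := by rw [Fin.le_def]; omega
      have hj0 : (0 : Fin (m+1)) < j := by
        rw [Fin.pos_iff_ne_zero]
        rintro rfl
        exact absurd (hk.trans_lt h2) (lt_irrefl _)
      refine h 0 j k hj0 hjk (lt_of_le_of_ne hk ?_) h2
      intro he
      have := σ.injective he
      subst this
      exact absurd (hj0.trans hjk) (lt_irrefl _)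
    · rw [narIns_succ, narIns_succ, mono] at h1
      exact h i j k (by simpa using hij) hjk h1 h2

lemma nar_des_ins {m : ℕ} (v : Fin (m+2)) (σ : Equiv.Perm (Fin (m+1))) :
    (DesFinset (narIns v σ)).card =
      (DesFinset σ).card + if (σ 0 : ℕ) < v then 1 else 0 := by
  unfold DesFinset
  rw [Finset.card_filter, Finset.card_filter, Fin.sum_univ_succ, add_comm]
  congr 1
  · apply Finset.sum_congr rfl
    intro i _
    congr 1
    apply propext
    constructor
    · rintro ⟨h, h'⟩
      have hh : (i : ℕ) + 1 < m + 1 := by simpa using h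
      refine ⟨hh, ?_⟩
      have e : (⟨(i.succ : ℕ) + 1, h⟩ : Fin (m+2)) = Fin.succ ⟨(i:ℕ)+1, hh⟩ := by ext; simp
      rw [e, narIns_succ, narIns_succ, Fin.succAbove_lt_succAbove_iff] at h'
      exact h'
    · rintro ⟨hh, h'⟩
      have h : (i.succ : ℕ) + 1 < m + 1 + 1 := by simpa using hh
      refine ⟨h, ?_⟩
      have e : (⟨(i.succ : ℕ) + 1, h⟩ : Fin (m+2)) = Fin.succ ⟨(i:ℕ)+1, hh⟩ := by ext; simp
      rw [e, narIns_succ, narIns_succ, Fin.succAbove_lt_succAbove_iff]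
      exact h'
  · congr 1
    apply propext
    have e : ∀ h, (⟨((0 : Fin (m+2)) : ℕ) + 1, h⟩ : Fin (m+2)) = Fin.succ 0 := by
      intro h; ext; simp
    have key : v.succAbove (σ 0) < v ↔ (σ 0 : ℕ) < v := by
      rw [Fin.succAbove_lt_iff_castSucc_lt, Fin.lt_def, Fin.val_castSucc]
    constructor
    · rintro ⟨h, h'⟩
      rw [e, narIns_succ, narIns_zero, key] at h'
      exact h'
    · intro h'
      refine ⟨by simp, ?_⟩
      rw [e, narIns_succ, narIns_zero, key]
      exact h'

/-- Number of avoiders of size `m+1` with first value `v` and `k` descents. -/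
def narA (m v k : ℕ) : ℕ :=
  (Finset.univ.filter (fun π : Equiv.Perm (Fin (m+1)) =>
    Avoids π pat132 ∧ (π 0 : ℕ) = v ∧ (DesFinset π).card = k)).card

lemma narA_big {m v k : ℕ} (h : m < v) : narA m v k = 0 := by
  unfold narA
  rw [Finset.card_eq_zero, Finset.filter_eq_empty_iff]
  rintro π - ⟨-, h2, -⟩
  have := (π 0).isLt
  omega

lemma narA_succ_aux (m v k : ℕ) (hv : v ≤ m + 1) :
    narA (m+1) v k = (Finset.univ.filter (fun σ : Equiv.Perm (Fin (m+1)) =>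
      Avoids σ pat132 ∧ (σ 0 : ℕ) ≤ v ∧
        (DesFinset σ).card + (if (σ 0 : ℕ) < v then 1 else 0) = k)).card := by
  symm
  unfold narA
  have hv' : v < m + 2 := by omega
  apply Finset.card_bij (fun σ _ => narIns ⟨v, hv'⟩ σ)
  · intro σ hσ
    simp only [Finset.mem_filter, Finset.mem_univ, true_and] at hσ ⊢
    rw [nar_avoids_ins, nar_des_ins, narIns_zero]
    exact ⟨⟨hσ.1, hσ.2.1⟩, rfl, hσ.2.2⟩
  · intro σ _ ρ _ h
    have := narIns_inj (a₁ := (⟨v, hv'⟩, σ)) (a₂ := (⟨v, hv'⟩, ρ)) h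
    exact (Prod.mk.inj this).2
  · intro π hπ
    simp only [Finset.mem_filter, Finset.mem_univ, true_and] at hπ
    obtain ⟨σ, hσ⟩ := narIns_surj π
    have e : π 0 = ⟨v, hv'⟩ := Fin.ext hπ.2.1
    rw [e] at hσ
    refine ⟨σ, ?_, hσ⟩
    rw [← hσ, nar_avoids_ins, nar_des_ins] at hπ
    simp only [Finset.mem_filter, Finset.mem_univ, true_and]
    exact ⟨hπ.1.1, hπ.1.2, hπ.2.2⟩

lemma nar_sum (m v k : ℕ) :
    (Finset.univ.filter (fun σ : Equiv.Perm (Fin (m+1)) =>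
      Avoids σ pat132 ∧ (σ 0 : ℕ) < v ∧ (DesFinset σ).card = k)).card
      = ∑ u ∈ Finset.range v, narA m u k := by
  rw [Finset.card_eq_sum_card_fiberwise (f := fun σ => (σ 0 : ℕ)) (t := Finset.range v)]
  · apply Finset.sum_congr rfl
    intro u hu
    unfold narA
    rw [Finset.filter_filter]
    congr 1
    ext σ
    simp only [Finset.mem_filter, Finset.mem_univ, true_and, Finset.mem_range] at hu ⊢
    constructor
    · rintro ⟨⟨a, b, c⟩, d⟩; exact ⟨a, d, c⟩
    · rintro ⟨a, d, c⟩; exact ⟨⟨a, by omega, c⟩, d⟩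
  · intro σ hσ
    simp at hσ ⊢
    exact hσ.2.1

lemma narA_succ (m v k : ℕ) (hv : v ≤ m + 1) :
    narA (m+1) v (k+1) = ∑ u ∈ Finset.range v, narA m u k + narA m v (k+1) := by
  rw [narA_succ_aux m v (k+1) hv, ← nar_sum]
  unfold narA
  rw [← Finset.card_union_of_disjoint]
  · congr 1
    ext σ
    simp only [Finset.mem_filter, Finset.mem_univ, true_and, Finset.mem_union]
    by_cases h : (σ 0 : ℕ) < v
    · simp [h, h.le, h.ne]
    · simp only [h, if_false, false_and, and_false, false_or, add_zero]
      have : (σ 0 : ℕ) ≤ v ↔ (σ 0 : ℕ) = v := by omega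
      rw [this]
  · rw [Finset.disjoint_left]
    intro σ h1 h2
    simp only [Finset.mem_filter, Finset.mem_univ, true_and] at h1 h2
    omega

lemma narA_succ_zero (m v : ℕ) (hv : v ≤ m + 1) :
    narA (m+1) v 0 = narA m v 0 := by
  rw [narA_succ_aux m v 0 hv]
  unfold narA
  congr 1
  ext σ
  simp only [Finset.mem_filter, Finset.mem_univ, true_and]
  by_cases h : (σ 0 : ℕ) < v
  · simp [h, h.ne]
  · simp only [h, if_false, add_zero]
    have : (σ 0 : ℕ) ≤ v ↔ (σ 0 : ℕ) = v := by omega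
    rw [this]

lemma narA_zero_zero (k : ℕ) : narA 0 0 k = if k = 0 then 1 else 0 := by
  have hd : ∀ π : Equiv.Perm (Fin (0+1)), (DesFinset π).card = 0 := by decide
  have ha : ∀ π : Equiv.Perm (Fin (0+1)), Avoids π pat132 := by decide
  unfold narA
  simp only [hd, ha, true_and]
  rcases k with _ | k
  · simp
  · simp

lemma narB_zero (m p : ℕ) : ∑ u ∈ Finset.range (p+1), narA m u 0 = 1 := by
  have h : ∀ m v, narA m v 0 = if v = 0 then 1 else 0 := by
    intro m
    induction m with
    | zero =>
      intro v
      rcases v with _ | v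
      · simp [narA_zero_zero]
      · simp [narA_big]
    | succ m ih =>
      intro v
      by_cases hv : v ≤ m + 1
      · rw [narA_succ_zero _ _ hv, ih]
      · rw [narA_big (by omega), if_neg (by omega)]
  simp [h]

lemma narB_succ (m k p : ℕ) (hp : p ≤ m + 1) :
    ∑ u ∈ Finset.range (p+1), narA m u (k+1) + p.choose (k+2) * m.choose k
      = p.choose (k+1) * m.choose (k+1) := by
  induction m generalizing k p with
  | zero =>
    have : p = 0 ∨ p = 1 := by omega
    rcases this with rfl | rfl
    · simp [narA_zero_zero]
    · simp [Finset.sum_range_succ, narA_zero_zero, narA_big, Nat.choose_eq_zero_of_lt]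
  | succ m ih =>
    have main : ∀ p ≤ m + 1, ∑ u ∈ Finset.range (p+1), narA (m+1) u (k+1)
        + p.choose (k+2) * (m+1).choose k = p.choose (k+1) * (m+1).choose (k+1) := by
      intro p
      induction p with
      | zero =>
        intro _
        have h1 := ih k 0 (by omega)
        simp only [zero_add, Finset.sum_range_one] at h1 ⊢
        rw [narA_succ _ _ _ (by omega)]
        simpa using h1
      | succ p ihp =>
        intro hp
        have h0 := ihp (by omega)
        rw [Finset.sum_range_succ, narA_succ _ _ _ hp]
        have h1 := ih k (p+1) hp
        have h2 := ih k p (by omega)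
        rw [Finset.sum_range_succ] at h1
        rcases k with _ | k
        · have h3 := narB_zero m p
          rw [h3]
          simp only [Nat.choose_succ_succ' p, Nat.choose_succ_succ' m, Nat.choose_zero_right,
            zero_add] at *
          nlinarith
        · have h3 := ih k p (by omega)
          simp only [Nat.choose_succ_succ' p, Nat.choose_succ_succ' m] at *
          nlinarith
    rcases Nat.lt_or_ge p (m+2) with h | h
    · exact main p (by omega)
    · obtain rfl : p = m + 2 := by omega
      have := main (m+1) le_rfl
      rw [Finset.sum_range_succ, narA_big (by omega)]
      rw [Nat.choose_succ_succ' (m+1) (k+1), Nat.choose_succ_succ' (m+1) k]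
      nlinarith

theorem stmt4 (n k : ℕ) (hn : 1 ≤ n) (hk : k ≤ n - 1) :
    ((Finset.univ.filter (fun π : Equiv.Perm (Fin n) =>
        Avoids π pat132 ∧ (DesFinset π).card = k)).card : ℚ)
      = (1 / n) * Nat.choose n k * Nat.choose n (k + 1) := by
  obtain ⟨m, rfl⟩ : ∃ m, n = m + 1 := ⟨n - 1, by omega⟩
  have e : (Finset.univ.filter (fun π : Equiv.Perm (Fin (m+1)) =>
        Avoids π pat132 ∧ (DesFinset π).card = k)).card
        = ∑ u ∈ Finset.range (m+1), narA m u k := by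
    rw [← nar_sum]
    congr 1
    ext π
    have := (π 0).isLt
    simp only [Finset.mem_filter, Finset.mem_univ, true_and, this]
  rw [e]
  rcases k with _ | k
  · rw [narB_zero]
    have : (m : ℚ) + 1 ≠ 0 := by positivity
    simp [this]
  · have hB := narB_succ m k m (by omega)
    have hq : ((∑ u ∈ Finset.range (m+1), narA m u (k+1) : ℕ) : ℚ)
      = m.choose (k+1) * m.choose (k+1) - m.choose (k+2) * m.choose k := by
      rw [eq_sub_iff_add_eq]; exact_mod_cast hB
    rw [hq]
    have hm : (m : ℚ) + 1 ≠ 0 := by positivity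
    have hkm : k + 1 ≤ m := by omega
    obtain ⟨d, rfl⟩ := Nat.exists_eq_add_of_le hkm
    -- express everything through C(m,k)
    have r1 := Nat.choose_succ_right_eq (k+1+d) k
    have r2 := Nat.choose_succ_right_eq (k+1+d) (k+1)
    rw [show k + 1 + d - k = d + 1 by omega] at r1
    rw [show k + 1 + d - (k+1) = d by omega] at r2
    rw [Nat.choose_succ_succ' (k+1+d) (k+1), Nat.choose_succ_succ' (k+1+d) k]
    have q1 : ((k+1+d).choose (k+1) : ℚ) = (k+1+d).choose k * (d+1) / (k+1) := by
      rw [eq_div_iff (by positivity)]; exact_mod_cast r1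
    have q2 : ((k+1+d).choose (k+2) : ℚ) = (k+1+d).choose (k+1) * d / (k+2) := by
      rw [eq_div_iff (by positivity)]; exact_mod_cast r2
    have e2 : k + 1 + 1 = k + 2 := rfl
    rw [e2]
    push_cast
    rw [q2, q1]
    have h1 : (k : ℚ) + 1 ≠ 0 := by positivity
    have h2 : (k : ℚ) + 2 ≠ 0 := by positivity
    have h3 : (k : ℚ) + 1 + d + 1 ≠ 0 := by positivity
    field_simp
    ring
end

section
/- For every n ≥ 1 and every k with 1 ≤ k ≤ n, the number of 321-avoiding permutations π of {1,…,n} having exactly k−1 indices i with π(i) = i+1 equals the ballot number b(n−1, n−k) = (k/(2n−k))·C(2n−k, n). -/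
open Finset

def gB : ℕ → ℕ → ℕ
  | 0, _ => 1
  | _ + 1, 0 => 0
  | s + 1, r + 1 => gB (s + 1) r + gB s (r + 2)
termination_by s r => (s, r)

lemma gB_closed (s r : ℕ) :
    gB (s + 1) r + Nat.choose (2 * s + r + 1) s = Nat.choose (2 * s + r + 1) (s + 1) := by
  induction s generalizing r with
  | zero =>
    induction r with
    | zero => simp [gB]
    | succ r ih => simp [gB] at ih ⊢; omega
  | succ s ihs =>
    induction r with
    | zero =>
      have := Nat.choose_symm_half (s + 1)
      simp only [gB]; rw [zero_add]
      exact this.symm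
    | succ r ih =>
      rw [gB]
      have h2 := ihs (r + 2)
      have e1 : 2 * (s + 1) + (r + 1) + 1 = (2 * (s + 1) + r + 1) + 1 := by ring
      have e2 : 2 * s + (r + 2) + 1 = 2 * (s + 1) + r + 1 := by ring
      rw [e2] at h2
      rw [e1, Nat.choose_succ_succ' _ s, Nat.choose_succ_succ' _ (s + 1)]
      omega

lemma gB_final (n k : ℕ) (hk1 : 1 ≤ k) (hkn : k ≤ n) :
    (gB (n - k) k : ℚ) = ((k : ℚ) / ((2 * n - k : ℕ) : ℚ)) * Nat.choose (2 * n - k) n := by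
  obtain ⟨s, rfl⟩ := Nat.exists_eq_add_of_le hkn
  have e : 2 * (k + s) - k = 2 * s + k := by omega
  rw [e, Nat.add_sub_cancel_left]
  cases s with
  | zero =>
    have : (k : ℚ) ≠ 0 := by positivity
    simp [gB, this]
  | succ s =>
    have h := gB_closed s k
    have h1 := Nat.add_one_mul_choose_eq (2 * s + k + 1) s
    have h2 := Nat.choose_succ_right_eq (2 * s + k + 1) s
    have e3 : 2 * s + k + 1 - s = s + k + 1 := by omega
    rw [e3] at h2
    have h3 : Nat.choose (2 * (s + 1) + k) (k + (s + 1)) = Nat.choose (2 * s + k + 1 + 1) (s + 1) := by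
      rw [show 2 * (s + 1) + k = 2 * s + k + 1 + 1 by ring]
      exact Nat.choose_symm_of_eq_add (by omega)
    rw [h3]
    generalize Nat.choose (2 * s + k + 1 + 1) (s + 1) = a at *
    generalize Nat.choose (2 * s + k + 1) (s + 1) = b at *
    generalize Nat.choose (2 * s + k + 1) s = c at *
    generalize gB (s + 1) k = g at *
    have hp : ((2 * (s + 1) + k : ℕ) : ℚ) ≠ 0 := by positivity
    have hs : ((s : ℚ) + 1) ≠ 0 := by positivity
    field_simp
    have h' : (g : ℚ) + c = b := by exact_mod_cast h
    have h1' : ((2 * s + k + 1 + 1 : ℚ)) * c = a * (s + 1) := by exact_mod_cast h1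
    have h2' : (b : ℚ) * (s + 1) = c * (s + k + 1) := by exact_mod_cast h2
    push_cast
    apply mul_right_cancel₀ hs
    linear_combination (2 * (s:ℚ) + k + 2) * (s + 1) * h' + (2 * (s:ℚ) + k + 2) * h2' + k * h1'

def fB (m h j : ℕ) : ℕ := if h + j ≤ m then gB (m - (h + j)) (2 * h + j + 1) else 0

lemma gB_two (s r : ℕ) : gB (s + 2) (r + 2) = gB (s + 2) r + 2 * gB (s + 1) (r + 2) + gB s (r + 4) := by
  have a1 : gB (s + 2) (r + 2) = gB (s + 2) (r + 1) + gB (s + 1) (r + 3) := by rw [gB]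
  have a2 : gB (s + 2) (r + 1) = gB (s + 2) r + gB (s + 1) (r + 2) := by rw [gB]
  have a3 : gB (s + 1) (r + 3) = gB (s + 1) (r + 2) + gB s (r + 4) := by rw [gB]
  omega

def cnt {m : ℕ} (f : Fin m → Bool) (x : ℕ) : ℕ :=
  (univ.filter (fun i : Fin m => (i : ℕ) < x ∧ f i = true)).card

lemma cnt_cons {m : ℕ} (a : Bool) (f : Fin m → Bool) (x : ℕ) :
    cnt (Fin.cons a f : Fin (m + 1) → Bool) (x + 1) = (if a = true then 1 else 0) + cnt f x := by
  simp only [cnt, card_filter, Fin.sum_univ_succ, Fin.cons_zero, Fin.cons_succ]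
  simp

lemma cnt_snoc {m : ℕ} (f : Fin m → Bool) (x : ℕ) :
    cnt (Fin.snoc f false : Fin (m + 1) → Bool) x = cnt f x := by
  simp only [cnt, card_filter, Fin.sum_univ_castSucc, Fin.snoc_castSucc, Fin.snoc_last]
  simp

lemma cnt_zero {m : ℕ} (f : Fin m → Bool) : cnt f 0 = 0 := by simp [cnt]

lemma cnt_mono {m : ℕ} (f : Fin m → Bool) {x y : ℕ} (h : x ≤ y) : cnt f x ≤ cnt f y := by
  apply card_le_card
  intro i
  simp only [mem_filter, mem_univ, true_and]
  exact fun hh => ⟨by omega, hh.2⟩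

lemma cnt_lt {m : ℕ} (f : Fin m → Bool) (i : Fin m) (hi : f i = true) {y : ℕ} (h : (i : ℕ) < y) :
    cnt f i < cnt f y := by
  apply card_lt_card
  refine ⟨fun j => ?_, fun hh => ?_⟩
  · simp only [mem_filter, mem_univ, true_and]
    exact fun hh => ⟨by omega, hh.2⟩
  · have : i ∈ _ := hh (by simp [hi, h])
    simp at this

lemma cnt_inj {m : ℕ} (f : Fin m → Bool) (i j : Fin m) (hi : f i = true) (hj : f j = true)
    (h : cnt f i = cnt f j) : i = j := by
  rcases lt_trichotomy i j with h1 | h1 | h1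
  · have := cnt_lt f i hi (y := j) h1
    omega
  · exact h1
  · have := cnt_lt f j hj (y := i) h1
    omega

lemma cnt_not {m : ℕ} (f : Fin m → Bool) (x : ℕ) (hx : x ≤ m) :
    cnt f x + cnt (fun i => !f i) x = x := by
  have h : (univ.filter (fun i : Fin m => (i : ℕ) < x)).card = x := by
    rw [Fin.card_filter_val_lt]; omega
  conv_rhs => rw [← h]
  rw [← card_filter_add_card_filter_not (s := univ.filter (fun i : Fin m => (i : ℕ) < x)) (fun i => f i = true)]
  simp [cnt, filter_filter]

def stW {m : ℕ} (h : ℕ) (u v : Fin m → Bool) : ℕ :=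
  (univ.filter (fun i : Fin m => u i = true ∧ v i = true ∧ h + cnt u i = cnt v i)).card

def Good {m : ℕ} (h j : ℕ) (u v : Fin m → Bool) : Prop :=
  (∀ x ≤ m, cnt v x ≤ h + cnt u x) ∧ cnt v m = h + cnt u m ∧ stW h u v = j

lemma stW_cons {m : ℕ} (h : ℕ) (a b : Bool) (u v : Fin m → Bool) (h' : ℕ)
    (hh : h + (if a = true then 1 else 0) = h' + (if b = true then 1 else 0)) :
    stW h (Fin.cons a u : Fin (m + 1) → Bool) (Fin.cons b v : Fin (m + 1) → Bool) =
      (if a = true ∧ b = true ∧ h = 0 then 1 else 0) + stW h' u v := by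
  simp only [stW, card_filter, Fin.sum_univ_succ, Fin.cons_zero, Fin.cons_succ, Fin.val_succ,
    cnt_cons, Fin.val_zero, cnt_zero, add_zero]
  congr 1
  apply sum_congr rfl
  intro i _
  congr 2
  apply propext
  have : (h + ((if a = true then 1 else 0) + cnt u i) = (if b = true then 1 else 0) + cnt v i) ↔ h' + cnt u i = cnt v i := by omega
  rw [this]

lemma Good_cons {m : ℕ} (h j : ℕ) (a b : Bool) (u v : Fin m → Bool) (h' j' : ℕ)
    (hh : h + (if a = true then 1 else 0) = h' + (if b = true then 1 else 0))
    (hj : j = (if a = true ∧ b = true ∧ h = 0 then 1 else 0) + j') :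
    Good h j (Fin.cons a u : Fin (m + 1) → Bool) (Fin.cons b v : Fin (m + 1) → Bool) ↔
      Good h' j' u v := by
  unfold Good
  rw [stW_cons h a b u v h' hh, cnt_cons, cnt_cons, hj]
  constructor
  · rintro ⟨h1, h2, h3⟩
    refine ⟨fun x hx => ?_, by omega, by omega⟩
    have := h1 (x + 1) (by omega)
    rw [cnt_cons, cnt_cons] at this
    omega
  · rintro ⟨h1, h2, h3⟩
    refine ⟨fun x hx => ?_, by omega, by omega⟩
    cases x with
    | zero => simp [cnt_zero]
    | succ x =>
      have := h1 x (by omega)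
      rw [cnt_cons, cnt_cons]
      omega

lemma Good_cons_bad {m : ℕ} (j : ℕ) (u v : Fin m → Bool) :
    ¬ Good 0 j (Fin.cons false u : Fin (m + 1) → Bool) (Fin.cons true v : Fin (m + 1) → Bool) := by
  rintro ⟨h1, -⟩
  have := h1 1 (by omega)
  have e1 := cnt_cons true v 0
  have e2 := cnt_cons false u 0
  rw [cnt_zero] at e1 e2
  simp only [zero_add] at e1 e2 this
  rw [e1, e2] at this
  simp at this

lemma Good_cons_bad' {m : ℕ} (u v : Fin m → Bool) :
    ¬ Good 0 0 (Fin.cons true u : Fin (m + 1) → Bool) (Fin.cons true v : Fin (m + 1) → Bool) := by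
  rintro ⟨-, -, h1⟩
  rw [stW_cons 0 true true u v 0 rfl] at h1
  simp at h1

open Classical in
noncomputable def NB (m h j : ℕ) : ℕ :=
  (univ.filter (fun w : (Fin m → Bool) × (Fin m → Bool) => Good h j w.1 w.2)).card

open Classical in
lemma NB_succ (m h j : ℕ) : NB (m + 1) h j = ∑ a : Bool, ∑ b : Bool,
    (univ.filter (fun w : (Fin m → Bool) × (Fin m → Bool) =>
      Good h j (Fin.cons a w.1 : Fin (m + 1) → Bool) (Fin.cons b w.2 : Fin (m + 1) → Bool))).card := by
  unfold NB
  simp only [card_filter, Fintype.sum_prod_type]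
  rw [← (Fin.consEquiv (fun _ : Fin (m + 1) => Bool)).sum_comp, Fintype.sum_prod_type]
  apply sum_congr rfl
  intro a _
  rw [sum_comm]
  rw [← (Fin.consEquiv (fun _ : Fin (m + 1) => Bool)).sum_comp, Fintype.sum_prod_type]
  apply sum_congr rfl
  intro b _
  rw [sum_comm]
  rfl

lemma NB_eq (m h j : ℕ) : NB m h j = fB m h j := by
  classical
  induction m generalizing h j with
  | zero =>
    unfold NB fB
    by_cases hc : h = 0 ∧ j = 0
    · obtain ⟨rfl, rfl⟩ := hc
      simp [Good, cnt, stW, gB]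
    · rw [if_neg (by omega), card_eq_zero, filter_eq_empty_iff]
      rintro w - ⟨-, h2, h3⟩
      simp [cnt, stW] at h2 h3
      omega
  | succ m ih =>
    rw [NB_succ]
    simp only [Fintype.sum_bool]
    rcases h with _ | h
    · simp only [Good_cons_bad, Good_cons 0 j true false _ _ 1 j rfl (by simp),
        Good_cons 0 j false false _ _ 0 j rfl (by simp)]
      rcases j with _ | j
      · simp only [Good_cons_bad']
        have e1 := ih 1 0
        have e2 := ih 0 0
        unfold NB at e1 e2
        simp only [filter_false, card_empty]
        rw [e1, e2]
        unfold fB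
        rcases m with _ | m
        · simp [gB]
        · simp [gB]
          ring
      · simp only [Good_cons 0 (j+1) true true _ _ 0 j rfl (by simp; ring)]
        have e1 := ih 1 (j+1)
        have e2 := ih 0 (j+1)
        have e3 := ih 0 j
        unfold NB at e1 e2 e3
        simp only [filter_false, card_empty]
        rw [e1, e2, e3]
        unfold fB
        rcases lt_or_ge m j with hm | hm
        · rw [if_neg (by omega), if_neg (by omega), if_neg (by omega), if_neg (by omega)]; rfl
        obtain ⟨d, rfl⟩ := Nat.exists_eq_add_of_le hm
        rcases d with _ | _ | d
        · rw [if_pos (by omega), if_neg (by omega), if_neg (by omega), if_pos (by omega)]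
          simp [gB]
        · rw [if_pos (by omega), if_neg (by omega), if_pos (by omega), if_pos (by omega)]
          have g1 : gB 1 (j + 2) = gB 1 (j + 1) + gB 0 (j + 3) := gB.eq_3 0 (j + 1)
          have g0 : ∀ r, gB 0 r = 1 := fun r => by rw [gB]
          have c1 : j + (0 + 1) - (0 + j) = 1 := by omega
          have c3 : j + (0 + 1) - (0 + (j + 1)) = 0 := by omega
          have c4 : j + (0 + 1) + 1 - (0 + (j + 1)) = 1 := by omega
          have c5 : 2 * 0 + j + 1 = j + 1 := by omega
          have c7 : 2 * 0 + (j + 1) + 1 = j + 2 := by omega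
          rw [c1, c3, c4, c5, c7, g1, g0, g0]; omega
        · rw [if_pos (by omega), if_pos (by omega), if_pos (by omega), if_pos (by omega)]
          have a1 : gB (d + 2) (j + 2) = gB (d + 2) (j + 1) + gB (d + 1) (j + 3) := by rw [gB]
          have a3 : gB (d + 1) (j + 3) = gB (d + 1) (j + 2) + gB d (j + 4) := by rw [gB]
          have c1 : j + (d + 1 + 1) - (0 + j) = d + 2 := by omega
          have c2 : j + (d + 1 + 1) - (1 + (j + 1)) = d := by omega
          have c3 : j + (d + 1 + 1) - (0 + (j + 1)) = d + 1 := by omega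
          have c4 : j + (d + 1 + 1) + 1 - (0 + (j + 1)) = d + 2 := by omega
          have c5 : 2 * 0 + j + 1 = j + 1 := by omega
          have c6 : 2 * 1 + (j + 1) + 1 = j + 4 := by omega
          have c7 : 2 * 0 + (j + 1) + 1 = j + 2 := by omega
          rw [c1, c2, c3, c4, c5, c6, c7]
          omega
    · simp only [Good_cons (h+1) j true false _ _ (h+2) j rfl (by simp),
        Good_cons (h+1) j false false _ _ (h+1) j rfl (by simp),
        Good_cons (h+1) j true true _ _ (h+1) j rfl (by simp),
        Good_cons (h+1) j false true _ _ h j rfl (by simp)]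
      have e1 := ih (h+2) j
      have e2 := ih (h+1) j
      have e3 := ih h j
      unfold NB at e1 e2 e3
      rw [e1, e2, e3]
      unfold fB
      rcases lt_or_ge m (h + j) with hm | hm
      · rw [if_neg (by omega), if_neg (by omega), if_neg (by omega), if_neg (by omega)]; rfl
      obtain ⟨d, rfl⟩ := Nat.exists_eq_add_of_le hm
      have c1 : 2 * h + j + 1 = 2 * h + j + 1 := by omega
      have c6 : 2 * (h + 2) + j + 1 = 2 * h + j + 5 := by omega
      have c7 : 2 * (h + 1) + j + 1 = 2 * h + j + 3 := by omega
      rw [c6, c7]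
      have c8 : h + j + d - (h + j) = d := by omega
      have c9 : h + j + d + 1 - (h + 1 + j) = d := by omega
      have c10 : h + j + d - (h + 1 + j) = d - 1 := by omega
      have c11 : h + j + d - (h + 2 + j) = d - 2 := by omega
      rw [c8, c9, c10, c11]
      rcases d with _ | _ | d
      · rw [if_neg (by omega), if_neg (by omega), if_pos (by omega), if_pos (by omega)]
        simp [gB]
      · rw [if_pos (by omega), if_neg (by omega), if_pos (by omega), if_pos (by omega)]
        simp [gB]
        ring
      · rw [if_pos (by omega), if_pos (by omega), if_pos (by omega), if_pos (by omega)]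
        have := gB_two d (2 * h + j + 1)
        simp only [add_assoc, Nat.reduceAdd, Nat.add_sub_cancel, Nat.reduceSubDiff] at this ⊢
        omega

def pA {n : ℕ} (π : Equiv.Perm (Fin n)) : Fin n → Bool := fun i => decide (i < π i)
def pB {n : ℕ} (π : Equiv.Perm (Fin n)) : Fin n → Bool := fun v => decide (π.symm v < v)

lemma pB_apply {n : ℕ} (π : Equiv.Perm (Fin n)) (i : Fin n) : pB π (π i) = pA π i := by
  simp [pA, pB]

lemma avoids_iff {n : ℕ} (π : Equiv.Perm (Fin n)) :
    Avoids π pat321 ↔ ∀ i j k, i < j → j < k → π j < π i → π k < π j → False := by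
  unfold Avoids Contains
  constructor
  · intro h i j k h1 h2 h3 h4
    apply h
    refine ⟨![i, j, k], ?_, ?_⟩
    · intro a b
      fin_cases a <;> fin_cases b <;> simp [h1, h2, h1.trans h2]
    · intro a b
      fin_cases a <;> fin_cases b <;>
        simp [pat321, h3, h4, h4.trans h3, h3.le, h4.le, (h4.trans h3).le]
  · rintro h ⟨f, h1, h2⟩
    refine h (f 0) (f 1) (f 2) (h1 _ _ (by decide)) (h1 _ _ (by decide))
      ((h2 _ _).1 (by decide)) ((h2 _ _).1 (by decide))

lemma exc1 {n : ℕ} (π : Equiv.Perm (Fin n)) (i j : Fin n) (hij : i < j) (h : π j < π i)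
    (hj : j < π j) : ∃ l, j < l ∧ π l < π j := by
  by_contra! hc
  have h1 : (Iio (π j)).card ≤ ((Iio j).erase i).card := by
    apply card_le_card_of_injOn π.symm
    · intro v hv
      have hv : v < π j := by simpa using hv
      have h2 : ¬ j < π.symm v := fun h3 => by
        have := hc _ h3
        rw [π.apply_symm_apply] at this
        exact absurd hv this.not_gt
      have h3 : π.symm v ≠ j := by
        rintro rfl
        simp at hv
      have h4 : π.symm v ≠ i := by
        rintro rfl
        rw [π.apply_symm_apply] at h
        exact absurd hv h.not_gt
      simp only [coe_erase, coe_Iio, Set.mem_diff, Set.mem_Iio, Set.mem_singleton_iff]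
      exact ⟨lt_of_le_of_ne (not_lt.1 h2) h3, h4⟩
    · exact π.symm.injective.injOn
  rw [card_erase_of_mem (by simpa using hij), Fin.card_Iio, Fin.card_Iio] at h1
  have : (j : ℕ) < π j := hj
  omega

lemma exc2 {n : ℕ} (π : Equiv.Perm (Fin n)) (i j : Fin n) (hij : i < j) (h : π j < π i)
    (hi : π i ≤ i) : ∃ l, l < i ∧ π i < π l := by
  by_contra! hc
  have h1 : (Iio i).card ≤ ((Iio (π i)).erase (π j)).card := by
    apply card_le_card_of_injOn π
    · intro v hv
      have hv : v < i := by simpa using hv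
      simp only [coe_erase, coe_Iio, Set.mem_diff, Set.mem_Iio, Set.mem_singleton_iff]
      refine ⟨lt_of_le_of_ne (hc v hv) (fun e => ?_), fun e => ?_⟩
      · exact hv.ne (π.injective e)
      · exact (hv.trans hij).ne (π.injective e)
    · exact π.injective.injOn
  rw [card_erase_of_mem (by simpa using h), Fin.card_Iio, Fin.card_Iio] at h1
  have h2 : (π i : ℕ) ≤ i := hi
  have h3 : (π j : ℕ) < π i := h
  omega

lemma mono1 {n : ℕ} (π : Equiv.Perm (Fin n)) (hπ : Avoids π pat321) (i j : Fin n)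
    (_ : pA π i = true) (hj : pA π j = true) (hij : i < j) : π i < π j := by
  rw [avoids_iff] at hπ
  by_contra hc
  have hc : π j < π i := lt_of_le_of_ne (not_lt.1 hc) (fun e => hij.ne' (π.injective e))
  obtain ⟨l, h1, h2⟩ := exc1 π i j hij hc (by simpa [pA] using hj)
  exact hπ i j l hij h1 hc h2

lemma mono2 {n : ℕ} (π : Equiv.Perm (Fin n)) (hπ : Avoids π pat321) (i j : Fin n)
    (hi : (!pA π i) = true) (_ : (!pA π j) = true) (hij : i < j) : π i < π j := by
  rw [avoids_iff] at hπ
  by_contra hc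
  have hc : π j < π i := lt_of_le_of_ne (not_lt.1 hc) (fun e => hij.ne' (π.injective e))
  obtain ⟨l, h1, h2⟩ := exc2 π i j hij hc (by simpa [pA] using hi)
  exact hπ l i j h1 hij h2 hc

lemma mono_cnt {n : ℕ} (π : Equiv.Perm (Fin n)) (A B : Fin n → Bool) (hB : ∀ i, B (π i) = A i)
    (hm : ∀ i j, A i = true → A j = true → i < j → π i < π j) (i : Fin n) (hi : A i = true) :
    cnt B (π i) = cnt A i := by
  symm
  apply card_bij (fun a _ => π a)
  · intro a ha
    simp only [mem_filter, mem_univ, true_and] at ha ⊢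
    exact ⟨hm a i ha.2 hi ha.1, by rw [hB]; exact ha.2⟩
  · intro a _ b _ e
    exact π.injective e
  · intro b hb
    simp only [mem_filter, mem_univ, true_and] at hb
    have e : A (π.symm b) = true := by rw [← hB]; simpa using hb.2
    refine ⟨π.symm b, ?_, by simp⟩
    simp only [mem_filter, mem_univ, true_and]
    refine ⟨?_, e⟩
    by_contra hc
    rcases (not_lt.1 hc : i ≤ π.symm b).lt_or_eq with h1 | h1
    · have := hm _ _ hi e h1
      rw [π.apply_symm_apply] at this
      exact absurd hb.1 (not_lt.2 this.le)
    · rw [h1] at hb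
      simp at hb

lemma pB_cnt_le {n : ℕ} (π : Equiv.Perm (Fin n)) (x : ℕ) : cnt (pB π) (x + 1) ≤ cnt (pA π) x := by
  apply card_le_card_of_injOn π.symm
  · intro v hv
    simp only [coe_filter, mem_univ, true_and, Set.mem_setOf_eq, pA, pB, decide_eq_true_eq,
      π.apply_symm_apply] at hv ⊢
    refine ⟨?_, hv.2⟩
    have : (π.symm v : ℕ) < v := hv.2
    omega
  · exact π.symm.injective.injOn

lemma cnt_all {n : ℕ} (π : Equiv.Perm (Fin n)) (A B : Fin n → Bool) (hB : ∀ i, B (π i) = A i) :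
    cnt B n = cnt A n := by
  symm
  apply card_bij (fun a _ => π a)
  · intro a ha
    simpa [hB] using ha
  · intro a _ b _ e
    exact π.injective e
  · intro b hb
    refine ⟨π.symm b, ?_, by simp⟩
    simp [← hB] at hb ⊢
    exact hb

lemma inj_AB {n : ℕ} (π σ : Equiv.Perm (Fin n)) (hπ : Avoids π pat321) (hσ : Avoids σ pat321)
    (hA : pA π = pA σ) (hB : pB π = pB σ) : π = σ := by
  ext1 i
  by_cases hi : pA π i = true
  · have h1 := mono_cnt π (pA π) (pB π) (pB_apply π) (mono1 π hπ) i hi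
    have h2 := mono_cnt σ (pA σ) (pB σ) (pB_apply σ) (mono1 σ hσ) i (hA ▸ hi)
    rw [← hA, ← hB] at h2
    exact cnt_inj (pB π) _ _ (by rw [pB_apply]; exact hi)
      (by rw [hB, pB_apply, ← hA]; exact hi) (h1.trans h2.symm)
  · have hi' : (!pA π i) = true := by simpa using hi
    have h1 := mono_cnt π (fun i => !pA π i) (fun i => !pB π i) (fun i => by simp [pB_apply])
      (mono2 π hπ) i hi'
    have h2 := mono_cnt σ (fun i => !pA σ i) (fun i => !pB σ i) (fun i => by simp [pB_apply])
      (mono2 σ hσ) i (hA ▸ hi')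
    rw [← hA, ← hB] at h2
    exact cnt_inj (fun i => !pB π i) _ _ (by simp only [pB_apply]; exact hi')
      (by simp only [hB, pB_apply, ← hA]; exact hi') (h1.trans h2.symm)

lemma surj_AB {n : ℕ} (A B : Fin n → Bool) (h : ∀ x < n, cnt B (x + 1) ≤ cnt A x)
    (hc : cnt B n = cnt A n) :
    ∃ π : Equiv.Perm (Fin n), Avoids π pat321 ∧ pA π = A ∧ pB π = B := by
  have card1 : (univ.filter (fun i => A i = true)).card = (univ.filter (fun i => B i = true)).card := by
    have e : ∀ f : Fin n → Bool, cnt f n = (univ.filter (fun i => f i = true)).card := by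
      intro f; simp [cnt]
    rw [← e, ← e, hc]
  have card2 : (univ.filter (fun i => ¬ A i = true)).card = (univ.filter (fun i => ¬ B i = true)).card := by
    have e1 := card_filter_add_card_filter_not (s := univ) (fun i => A i = true)
    have e2 := card_filter_add_card_filter_not (s := univ) (fun i => B i = true)
    omega
  have key : ∀ (p q : Fin n → Prop) [DecidablePred p] [DecidablePred q],
      (univ.filter p).card = (univ.filter q).card →
      ∃ e : {x // p x} ≃ {x // q x}, StrictMono e := by
    intro p q _ _ hpq
    have hp : Fintype.card {x // p x} = (univ.filter p).card := Fintype.card_subtype p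
    have hq : Fintype.card {x // q x} = (univ.filter p).card := by
      rw [hpq]; exact Fintype.card_subtype q
    let e := (Fintype.orderIsoFinOfCardEq {x // p x} hp).symm.trans
      (Fintype.orderIsoFinOfCardEq {x // q x} hq)
    exact ⟨e.toEquiv, e.strictMono⟩
  obtain ⟨e, he⟩ := key _ _ card1
  obtain ⟨f, hf⟩ := key _ _ card2
  let π : Equiv.Perm (Fin n) := Equiv.subtypeCongr e f
  have p1 : ∀ i (hi : A i = true), π i = e ⟨i, hi⟩ := by
    intro i hi
    simp [π, Equiv.subtypeCongr, hi]
  have p2 : ∀ i (hi : ¬ A i = true), π i = f ⟨i, hi⟩ := by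
    intro i hi
    simp [π, Equiv.subtypeCongr, Equiv.sumCompl_symm_apply_of_neg, hi]
  have hB : ∀ i, B (π i) = A i := by
    intro i
    by_cases hi : A i = true
    · rw [p1 i hi, hi]; exact (e ⟨i, hi⟩).2
    · rw [p2 i hi]
      have := (f ⟨i, hi⟩).2
      simp only [Bool.not_eq_true] at hi this
      rw [hi, this]
  have m1 : ∀ i j, A i = true → A j = true → i < j → π i < π j := by
    intro i j hi hj hij
    rw [p1 i hi, p1 j hj]
    exact he (a := ⟨i, hi⟩) (b := ⟨j, hj⟩) hij
  have m2 : ∀ i j, (!A i) = true → (!A j) = true → i < j → π i < π j := by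
    intro i j hi hj hij
    have hi : ¬ A i = true := by simpa using hi
    have hj : ¬ A j = true := by simpa using hj
    rw [p2 i hi, p2 j hj]
    exact hf (a := ⟨i, hi⟩) (b := ⟨j, hj⟩) hij
  have hA : ∀ i, pA π i = A i := by
    intro i
    have hx := h i i.2
    by_cases hi : A i = true
    · have h1 := mono_cnt π A B hB m1 i hi
      rw [hi, pA, decide_eq_true_eq]
      by_contra hcon
      have hcon : (π i : ℕ) ≤ i := not_lt.1 hcon
      have := cnt_lt B (π i) (by rw [hB, hi]) (y := i + 1) (by omega)
      omega
    · have hi' : (!A i) = true := by simpa using hi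
      have h1 := mono_cnt π (fun i => !A i) (fun i => !B i) (fun i => by simp [hB]) m2 i hi'
      have hi2 : A i = false := by simpa using hi
      rw [hi2, pA, decide_eq_false_iff_not]
      intro hcon
      have hcon : (i : ℕ) < π i := hcon
      have t1 := cnt_mono (fun i => !B i) (show (i : ℕ) + 1 ≤ π i by omega)
      have t2 := cnt_not A i i.2.le
      have t3 := cnt_not B (i + 1) i.2
      omega
  refine ⟨π, ?_, funext hA, ?_⟩
  · rw [avoids_iff]
    intro i j k hij hjk h1 h2
    have a1 : ¬ (A i = A j) := by
      intro ee
      by_cases hj : A j = true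
      · exact absurd (m1 i j (ee.trans hj) hj hij) h1.not_gt
      · exact absurd (m2 i j (by simpa [ee] using hj) (by simpa using hj) hij) h1.not_gt
    have a2 : ¬ (A j = A k) := by
      intro ee
      by_cases hj : A j = true
      · exact absurd (m1 j k hj (ee ▸ hj) hjk) h2.not_gt
      · exact absurd (m2 j k (by simpa using hj) (by simpa [← ee] using hj) hjk) h2.not_gt
    have a3 : ¬ (A i = A k) := by
      intro ee
      by_cases hj : A i = true
      · exact absurd (m1 i k hj (ee ▸ hj) (hij.trans hjk)) (h2.trans h1).not_gt
      · exact absurd (m2 i k (by simpa using hj) (by simpa [← ee] using hj) (hij.trans hjk)) (h2.trans h1).not_gt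
    revert a1 a2 a3
    cases A i <;> cases A j <;> cases A k <;> simp
  · funext v
    have := hB (π.symm v)
    have h2 := pB_apply π (π.symm v)
    rw [π.apply_symm_apply] at this h2
    rw [this, h2, hA]

def wU {m : ℕ} (π : Equiv.Perm (Fin (m + 1))) : Fin m → Bool := fun i => pA π i.castSucc
def wV {m : ℕ} (π : Equiv.Perm (Fin (m + 1))) : Fin m → Bool := fun i => pB π i.succ

lemma pA_eq {m : ℕ} (π : Equiv.Perm (Fin (m + 1))) : pA π = Fin.snoc (wU π) false := by
  funext i
  refine Fin.lastCases ?_ (fun i => ?_) i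
  · simp [pA, Fin.le_last]
  · simp [wU]

lemma pB_eq {m : ℕ} (π : Equiv.Perm (Fin (m + 1))) : pB π = Fin.cons false (wV π) := by
  funext i
  refine Fin.cases ?_ (fun i => ?_) i
  · simp [pB]
  · simp [wV]

lemma cntA_eq {m : ℕ} (π : Equiv.Perm (Fin (m + 1))) (x : ℕ) : cnt (pA π) x = cnt (wU π) x := by
  rw [pA_eq, cnt_snoc]

lemma cntB_eq {m : ℕ} (π : Equiv.Perm (Fin (m + 1))) (x : ℕ) :
    cnt (pB π) (x + 1) = cnt (wV π) x := by
  rw [pB_eq, cnt_cons]; simp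

lemma cnt_top {m : ℕ} (f : Fin m → Bool) : cnt f (m + 1) = cnt f m := by
  unfold cnt
  congr 1
  ext i
  have := i.2
  simp

lemma stat_eq {m : ℕ} (π : Equiv.Perm (Fin (m + 1))) (hπ : Avoids π pat321) :
    (univ.filter (fun i : Fin (m + 1) => (π i : ℕ) = (i : ℕ) + 1)).card = stW 0 (wU π) (wV π) := by
  unfold stW
  rw [card_filter, card_filter, Fin.sum_univ_castSucc]
  have hl : ¬ ((π (Fin.last m) : ℕ) = (Fin.last m : ℕ) + 1) := by
    have := (π (Fin.last m)).2
    simp; omega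
  rw [if_neg hl, add_zero]
  apply sum_congr rfl
  intro i _
  congr 1
  apply propext
  rw [zero_add, ← cntA_eq, ← cntB_eq]
  simp only [wU, wV]
  have hcast : ((i.castSucc : Fin (m + 1)) : ℕ) = i := rfl
  have hsucc : ((i.succ : Fin (m + 1)) : ℕ) = i + 1 := by simp
  constructor
  · intro h
    have e : π i.castSucc = i.succ := by
      apply Fin.ext; rw [h, hcast, hsucc]
    have ha : pA π i.castSucc = true := by
      rw [pA, decide_eq_true_eq, e]; exact Fin.castSucc_lt_succ
    refine ⟨ha, ?_, ?_⟩
    · rw [← e, pB_apply]; exact ha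
    · have := mono_cnt π (pA π) (pB π) (pB_apply π) (mono1 π hπ) _ ha
      rw [e, hsucc, hcast] at this
      exact this.symm
  · rintro ⟨h1, h2, h3⟩
    have hj : pA π (π.symm i.succ) = true := by
      rw [← pB_apply, π.apply_symm_apply]; exact h2
    have := mono_cnt π (pA π) (pB π) (pB_apply π) (mono1 π hπ) _ hj
    rw [π.apply_symm_apply, hsucc, ← h3, ← hcast] at this
    have e := cnt_inj (pA π) _ _ h1 hj this
    rw [e, π.apply_symm_apply, ← e, hcast, hsucc]

lemma main_count (m j : ℕ) :
    (univ.filter (fun π : Equiv.Perm (Fin (m + 1)) =>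
        Avoids π pat321 ∧
        (univ.filter (fun i : Fin (m + 1) => (π i : ℕ) = (i : ℕ) + 1)).card = j)).card = NB m 0 j := by
  classical
  unfold NB
  apply card_bij (fun π _ => (wU π, wV π))
  · intro π hπ
    simp only [mem_filter, mem_univ, true_and] at hπ ⊢
    obtain ⟨h1, h2⟩ := hπ
    rw [stat_eq π h1] at h2
    refine ⟨fun x _ => ?_, ?_, h2⟩
    · rw [zero_add, ← cntA_eq, ← cntB_eq]
      exact pB_cnt_le π x
    · have := cnt_all π (pA π) (pB π) (pB_apply π)
      rw [cntA_eq, cntB_eq, cnt_top] at this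
      rw [this, zero_add]
  · intro π hπ σ hσ e
    simp only [mem_filter, mem_univ, true_and] at hπ hσ
    obtain ⟨e1, e2⟩ := Prod.mk.inj e
    exact inj_AB π σ hπ.1 hσ.1 (by rw [pA_eq, pA_eq, e1]) (by rw [pB_eq, pB_eq, e2])
  · rintro ⟨u, v⟩ hw
    simp only [mem_filter, mem_univ, true_and] at hw
    obtain ⟨h1, h2, h3⟩ := hw
    obtain ⟨π, p1, p2, p3⟩ := surj_AB (Fin.snoc u false : Fin (m + 1) → Bool) (Fin.cons false v : Fin (m + 1) → Bool)
      (fun x hx => by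
        rw [cnt_snoc, cnt_cons]
        have := h1 x (by omega)
        simpa using this)
      (by rw [cnt_snoc, cnt_cons, cnt_top, h2]; simp)
    have q1 : wU π = u := by
      funext i
      simp [wU, p2]
    have q2 : wV π = v := by
      funext i
      simp [wV, p3]
    refine ⟨π, ?_, by rw [q1, q2]⟩
    simp only [mem_filter, mem_univ, true_and]
    refine ⟨p1, ?_⟩
    rw [stat_eq π p1, q1, q2, h3]

/-- The number of 321-avoiding permutations of {1,…,n} with exactly k−1 positions
i such that π(i) = i+1 equals the ballot number
b(n−1, n−k) = (k/(2n−k))·C(2n−k, n). -/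
theorem stmt6 (n k : ℕ) (hn : 1 ≤ n) (hk1 : 1 ≤ k) (hkn : k ≤ n) :
    ((Finset.univ.filter (fun π : Equiv.Perm (Fin n) =>
        Avoids π pat321 ∧
        (Finset.univ.filter (fun i : Fin n => (π i : ℕ) = (i : ℕ) + 1)).card = k - 1)).card : ℚ)
      = ((k : ℚ) / ((2 * n - k : ℕ) : ℚ)) * Nat.choose (2 * n - k) n := by
  obtain ⟨m, rfl⟩ := Nat.exists_eq_add_of_le' hn
  rw [main_count m (k - 1), NB_eq, ← gB_final (m + 1) k hk1 hkn, fB, if_pos (by omega)]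
  congr 2 <;> omega
end

section
/- For every n ≥ 1 and every k with 1 ≤ k ≤ n, the number of partitions λ = (λ_1 ≥ … ≥ λ_{n−1} ≥ 0) with λ_i ≤ n−i for all i that have exactly k−1 corners on the diagonal i+j = n (i.e., exactly k−1 indices i with λ_i = n−i, λ_i > 0, and λ_i > λ_{i+1}, where λ_n := 0) equals the ballot number b(n−1, n−k) = (k/(2n−k))·C(2n−k, n). -/
/-- Partitions λ = (λ_1 ≥ … ≥ λ_{n-1} ≥ 0) with λ_i ≤ n-i, encoded as functions
`f : Fin n → Fin n` where `f i` is the part λ_{i+1} (0-indexed positions), together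
with the convention λ_n = 0 (forced by `f i ≤ n - 1 - i`). -/
def Yn (n : ℕ) : Finset (Fin n → Fin n) :=
  Finset.univ.filter (fun f =>
    (∀ i j : Fin n, i ≤ j → f j ≤ f i) ∧ ∀ i : Fin n, (f i : ℕ) ≤ n - 1 - (i : ℕ))

/-- The corners of the Young diagram lying on the diagonal i + j = n: (1-based)
indices i with λ_i > 0, λ_i > λ_{i+1} (where λ_n := 0) and λ_i + i = n. -/
def diagCorners (n : ℕ) (f : Fin n → Fin n) : Finset (Fin n) :=
  Finset.univ.filter (fun i =>
    (0 : ℕ) < (f i : ℕ) ∧ (∀ h : (i : ℕ) + 1 < n, f ⟨(i : ℕ) + 1, h⟩ < f i) ∧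
    (f i : ℕ) + (i : ℕ) + 1 = n)

def touchN (a : ℕ) (f : Fin a → ℕ) : ℕ := ∑ i : Fin a, if f i + (i : ℕ) + 1 = a then 1 else 0

def PS (a b c : ℕ) : Set (Fin a → ℕ) :=
  {f | Antitone f ∧ (∀ i, f i + (i : ℕ) + 1 ≤ a) ∧ (∀ i, f i ≤ b) ∧ touchN a f = c}

theorem PS_finite (a b c : ℕ) : (PS a b c).Finite :=
  (Set.finite_Iic (fun _ : Fin a => b)).subset (fun _ hf => fun i => hf.2.2.1 i)

theorem touchN_cons (a x : ℕ) (f : Fin a → ℕ) :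
    touchN (a+1) (Fin.cons x f) = (if x = a then 1 else 0) + touchN a f := by
  unfold touchN
  rw [Fin.sum_univ_succ]
  congr 1
  · simp
  · apply Finset.sum_congr rfl
    intro i _
    simp only [Fin.cons_succ, Fin.val_succ]
    congr 1
    apply propext
    omega

theorem cons_mem (a b c : ℕ) (hb : b ≤ a) (f : Fin a → ℕ) :
    (Fin.cons b f : Fin (a+1) → ℕ) ∈ PS (a+1) b c ↔
      ∃ c', c = (if b = a then 1 else 0) + c' ∧ f ∈ PS a b c' := by
  unfold PS
  simp only [Set.mem_ofPred_eq, touchN_cons]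
  constructor
  · rintro ⟨h1, h2, h3, h4⟩
    refine ⟨touchN a f, h4.symm, ?_, ?_, ?_, rfl⟩
    · intro i j hij
      have := h1 (Fin.succ_le_succ_iff.mpr hij)
      simpa using this
    · intro i
      have := h2 i.succ
      simp at this
      omega
    · intro i
      have := h3 i.succ
      simpa using this
  · rintro ⟨c', hc, h1, h2, h3, h4⟩
    refine ⟨?_, ?_, ?_, by rw [h4, hc]⟩
    · intro i j hij
      induction i using Fin.cases with
      | zero =>
        induction j using Fin.cases with
        | zero => simp
        | succ j => simpa using h3 j
      | succ i =>
        induction j using Fin.cases with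
        | zero => simp at hij
        | succ j => simpa using h1 (Fin.succ_le_succ_iff.mp hij)
    · intro i
      induction i using Fin.cases with
      | zero => simp; omega
      | succ i =>
        have := h2 i
        simp; omega
    · intro i
      induction i using Fin.cases with
      | zero => simp
      | succ i => simpa using h3 i

theorem PS_split (a b c : ℕ) :
    PS (a+1) (b+1) c = PS (a+1) b c ∪
      (fun g : Fin a → ℕ => (Fin.cons (b+1) g : Fin (a+1) → ℕ)) '' {f | (Fin.cons (b+1) f : Fin (a+1) → ℕ) ∈ PS (a+1) (b+1) c} := by
  ext f
  constructor
  · intro hf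
    by_cases h : f 0 = b + 1
    · right
      have e : (Fin.cons (b+1) (Fin.tail f) : Fin (a+1) → ℕ) = f := by
        rw [← h]; exact Fin.cons_self_tail f
      refine ⟨Fin.tail f, ?_, e⟩
      simp only [Set.mem_ofPred_eq]
      rw [e]; exact hf
    · left
      obtain ⟨h1, h2, h3, h4⟩ := hf
      refine ⟨h1, h2, ?_, h4⟩
      intro i
      have := h1 (Fin.zero_le i)
      have := h3 0
      omega
  · rintro (h | ⟨g, hg, rfl⟩)
    · obtain ⟨h1, h2, h3, h4⟩ := h
      exact ⟨h1, h2, fun i => (h3 i).trans (Nat.le_succ b), h4⟩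
    · exact hg

theorem PS_card_split (a b c : ℕ) :
    (PS (a+1) (b+1) c).ncard = (PS (a+1) b c).ncard +
      {f : Fin a → ℕ | (Fin.cons (b+1) f : Fin (a+1) → ℕ) ∈ PS (a+1) (b+1) c}.ncard := by
  have hinj : Function.Injective (fun g : Fin a → ℕ => (Fin.cons (b+1) g : Fin (a+1) → ℕ)) :=
    Fin.cons_right_injective (α := fun _ => ℕ) (b+1)
  have hfin := PS_finite (a+1) (b+1) c
  rw [PS_split] at hfin
  conv_lhs => rw [PS_split]
  rw [Set.ncard_union_eq _ (PS_finite _ _ _) (hfin.subset Set.subset_union_right),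
    Set.ncard_image_of_injective _ hinj]
  rw [Set.disjoint_left]
  rintro f hf ⟨g, _, rfl⟩
  have := hf.2.2.1 0
  simp at this

theorem PS_rec_lt (a b c : ℕ) (h : b + 1 < a) :
    (PS (a+1) (b+1) c).ncard = (PS (a+1) b c).ncard + (PS a (b+1) c).ncard := by
  rw [PS_card_split]
  congr 2
  ext f
  rw [Set.mem_ofPred_eq, cons_mem _ _ _ h.le]
  simp [h.ne]

theorem PS_rec_eq (b c : ℕ) :
    (PS (b+2) (b+1) (c+1)).ncard = (PS (b+2) b (c+1)).ncard + (PS (b+1) b c).ncard := by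
  rw [PS_card_split]
  congr 2
  ext f
  rw [Set.mem_ofPred_eq, cons_mem _ _ _ le_rfl]
  simp only [if_true]
  constructor
  · rintro ⟨c', h, h1, h2, h3, h4⟩
    refine ⟨h1, h2, fun i => ?_, by omega⟩
    have := h2 i
    omega
  · rintro ⟨h1, h2, h3, h4⟩
    exact ⟨c, by omega, h1, h2, fun i => (h3 i).trans (Nat.le_succ b), h4⟩

theorem touch_pos (a : ℕ) (f : Fin (a+1) → ℕ) (h2 : ∀ i, f i + (i : ℕ) + 1 ≤ a+1) :
    touchN (a+1) f = (∑ i : Fin a, if f i.castSucc + (i : ℕ) + 1 = a + 1 then 1 else 0) + 1 := by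
  unfold touchN
  rw [Fin.sum_univ_castSucc]
  have := h2 (Fin.last a)
  simp at this
  simp [this]

theorem PS_zero (a b : ℕ) : (PS (a+1) b 0).ncard = 0 := by
  rw [Set.ncard_eq_zero (PS_finite _ _ _)]
  ext f
  simp only [Set.mem_empty_iff_false, iff_false]
  rintro ⟨h1, h2, h3, h4⟩
  rw [touch_pos a f h2] at h4
  omega

theorem PS_base (a d : ℕ) : (PS (a+1) 0 (d+1)).ncard = if d = 0 then 1 else 0 := by
  have key : ∀ f : Fin (a+1) → ℕ, (∀ i, f i ≤ 0) → touchN (a+1) f = 1 := by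
    intro f hf
    have : ∀ i, f i = 0 := fun i => Nat.le_zero.mp (hf i)
    rw [touch_pos]
    · simp only [this]
      simp only [Nat.add_eq_right, Finset.sum_eq_zero_iff]
      intro i _
      have := i.2
      rw [if_neg]; omega
    · intro i
      have h := i.2
      rw [this]; omega
  split_ifs with h
  · subst h
    rw [Set.ncard_eq_one]
    refine ⟨fun _ => 0, ?_⟩
    ext f
    simp only [Set.mem_singleton_iff]
    constructor
    · rintro ⟨h1, h2, h3, h4⟩
      funext i
      exact Nat.le_zero.mp (h3 i)
    · rintro rfl
      refine ⟨fun _ _ _ => le_rfl, fun i => ?_, fun _ => le_rfl, key _ fun _ => le_rfl⟩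
      have := i.2
      show 0 + (i : ℕ) + 1 ≤ a + 1
      omega
  · rw [Set.ncard_eq_zero (PS_finite _ _ _)]
    ext f
    simp only [Set.mem_empty_iff_false, iff_false]
    rintro ⟨h1, h2, h3, h4⟩
    rw [key f h3] at h4
    omega

def BB (s : ℕ) : ℕ → ℤ
  | 0 => 1
  | e+1 => (s.choose (e+1) : ℤ) - s.choose e

theorem BB_rec (s e : ℕ) : BB (s+1) (e+1) = BB s e + BB s (e+1) := by
  cases e with
  | zero => simp [BB]
  | succ e =>
    simp only [BB, Nat.choose_succ_succ' s]
    push_cast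
    ring

theorem BB_odd (e : ℕ) : BB (2*e+1) (e+1) = 0 := by
  simp only [BB]
  rw [Nat.choose_symm_half]
  ring

theorem PS_formula (a : ℕ) : ∀ b d : ℕ, b ≤ a →
    ((PS (a+1) b (d+1)).ncard : ℤ) = if b < d then 0 else BB (a+b-d) (b-d) := by
  induction a with
  | zero =>
    intro b d hb
    obtain rfl : b = 0 := by omega
    rw [PS_base]
    rcases d with _ | d <;> simp [BB]
  | succ a iha =>
    intro b
    induction b with
    | zero =>
      intro d hb
      rw [PS_base]
      rcases d with _ | d <;> simp [BB]
    | succ b ihb =>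
      intro d hb
      have ih1 := ihb d (by omega)
      rcases Nat.lt_or_ge b a with h | h
      · rw [PS_rec_lt _ _ _ (by omega)]
        push_cast
        rw [ih1, iha _ _ (by omega)]
        rcases lt_trichotomy (b+1) d with h' | h' | h'
        · simp [h', show b < d by omega]
        · subst h'
          simp [BB]
        · obtain ⟨e, rfl⟩ : ∃ e, b = d + e := ⟨b - d, by omega⟩
          rw [if_neg (by omega), if_neg (by omega), if_neg (by omega)]
          rw [show a + 1 + (d+e+1) - d = (a + e + 1) + 1 by omega,
            show d + e + 1 - d = e + 1 by omega, show a + 1 + (d+e) - d = a + e + 1 by omega,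
            show d + e - d = e by omega, show a + (d + e + 1) - d = a + e + 1 by omega, BB_rec (_ + 1)]
      · obtain rfl : b = a := by omega
        rw [PS_rec_eq]
        push_cast
        rw [ih1]
        rcases d with _ | d
        · rw [PS_zero]
          simp only [Nat.not_lt_zero, if_false, Nat.sub_zero]
          rw [show b + 1 + (b+1) = (2*b+1)+1 by ring, BB_rec, BB_odd,
            show b + 1 + b = 2*b+1 by ring]
          simp
        · rw [iha _ _ (by omega)]
          rcases lt_trichotomy b d with h' | h' | h'
          · simp [h', show b < d + 1 by omega]
          · subst h'
            simp [BB]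
          · obtain ⟨e, rfl⟩ : ∃ e, b = d + 1 + e := ⟨b - d - 1, by omega⟩
            rw [if_neg (by omega), if_neg (by omega), if_neg (by omega)]
            rw [show d + 1 + e + 1 + (d + 1 + e + 1) - (d + 1) = (d + 1 + e + e + 1) + 1 by omega,
              show d + 1 + e + 1 - (d + 1) = e + 1 by omega,
              show d + 1 + e + 1 + (d + 1 + e) - (d + 1) = d + 1 + e + e + 1 by omega,
              show d + 1 + e - (d + 1) = e by omega,
              show d + 1 + e + (d + 1 + e) - d = d + 1 + e + e + 1 by omega,
              show d + 1 + e - d = e + 1 by omega, BB_rec (_ + 1)]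

theorem BB_closed (d e : ℕ) :
    BB (d + 2*e) e * (d + 1 + 2*e : ℤ) = (d+1) * ((d+1+2*e).choose e : ℤ) := by
  cases e with
  | zero => simp [BB]
  | succ e =>
    have h := Nat.choose_succ_right_eq (d + 2*(e+1)) e
    rw [show d + 2*(e+1) - e = d + e + 2 by omega] at h
    have h' : ((d + 2*(e+1)).choose (e+1) : ℤ) * (e+1) = (d + 2*(e+1)).choose e * (d+e+2) := by
      exact_mod_cast h
    rw [show d + 1 + 2*(e+1) = (d + 2*(e+1)) + 1 by ring, Nat.choose_succ_succ']
    simp only [BB]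
    push_cast
    linear_combination 2 * h'

theorem card_eq (a d : ℕ) :
    ((Yn (a+1)).filter (fun f => (diagCorners (a+1) f).card = d)).card
      = (PS (a+1) a (d+1)).ncard := by
  have hc : ∀ f : Fin (a+1) → Fin (a+1), (∀ i : Fin (a+1), (f i : ℕ) ≤ a + 1 - 1 - (i : ℕ)) →
      touchN (a+1) (fun i => (f i : ℕ)) = (diagCorners (a+1) f).card + 1 := by
    intro f hf
    rw [touch_pos]
    · congr 1
      unfold diagCorners
      rw [Finset.card_filter, Fin.sum_univ_castSucc]
      have hl := hf (Fin.last a)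
      simp only [Fin.val_last] at hl
      rw [if_neg (c := _ ∧ _) (by omega), add_zero]
      apply Finset.sum_congr rfl
      intro i _
      congr 1
      apply propext
      constructor
      · intro h
        have := i.2
        refine ⟨by omega, ?_, by simpa using h⟩
        intro hh
        have := hf ⟨(i.castSucc : ℕ) + 1, hh⟩
        rw [Fin.lt_def]
        simp only [Fin.val_castSucc] at *
        omega
      · rintro ⟨_, _, h⟩
        simpa using h
    · intro i
      have := hf i
      have := i.2
      omega
  rw [← Set.ncard_coe_finset]
  have hinj : Function.Injective (fun (f : Fin (a+1) → Fin (a+1)) (i : Fin (a+1)) => (f i : ℕ)) := by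
    intro f g h
    funext i
    exact Fin.ext (congrFun h i)
  rw [← Set.ncard_image_of_injective _ hinj]
  congr 1
  ext g
  simp only [Set.mem_image, Finset.coe_filter, Set.mem_ofPred_eq, Yn, Finset.mem_filter,
    Finset.mem_univ, true_and]
  constructor
  · rintro ⟨f, ⟨⟨h1, h2⟩, h3⟩, rfl⟩
    refine ⟨fun i j hij => h1 i j hij, fun i => ?_, fun i => ?_, ?_⟩
    · have := h2 i
      have := i.2
      simp only
      omega
    · have := (f i).2
      simp only
      omega
    · rw [hc f h2, h3]
  · rintro ⟨h1, h2, h3, h4⟩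
    have h2' : ∀ i : Fin (a+1), g i ≤ a + 1 - 1 - (i : ℕ) := fun i => by have := h2 i; omega
    refine ⟨fun i => ⟨g i, Nat.lt_succ_of_le (h3 i)⟩, ⟨⟨fun i j hij => h1 hij, h2'⟩, ?_⟩, rfl⟩
    have := hc (fun i => ⟨g i, Nat.lt_succ_of_le (h3 i)⟩) h2'
    simp only at this
    rw [h4] at this
    omega

/-- The number of partitions fitting inside the staircase (n−1,…,1) with exactly
k−1 corners on the diagonal i+j = n equals the ballot number
b(n−1, n−k) = (k/(2n−k))·C(2n−k, n). -/
theorem stmt7 (n k : ℕ) (hn : 1 ≤ n) (hk1 : 1 ≤ k) (hkn : k ≤ n) :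
    (((Yn n).filter (fun f => (diagCorners n f).card = k - 1)).card : ℚ)
      = ((k : ℚ) / ((2 * n - k : ℕ) : ℚ)) * Nat.choose (2 * n - k) n := by
  obtain ⟨d, rfl⟩ : ∃ d, k = d + 1 := ⟨k - 1, by omega⟩
  obtain ⟨e, rfl⟩ : ∃ e, n = d + e + 1 := ⟨n - d - 1, by omega⟩
  rw [Nat.add_sub_cancel, card_eq]
  have h1 := PS_formula (d+e) (d+e) d le_rfl
  rw [if_neg (by omega), show d + e + (d+e) - d = d + 2*e by omega,
    show d + e - d = e by omega] at h1
  have h2 := BB_closed d e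
  rw [← h1] at h2
  rw [show 2 * (d + e + 1) - (d+1) = d + 1 + 2*e by omega]
  have h3 : (d + 1 + 2*e).choose (d+e+1) = (d + 1 + 2*e).choose e :=
    Nat.choose_symm_of_eq_add (by ring)
  rw [h3]
  have h4 : ((PS (d+e+1) (d+e) (d+1)).ncard : ℚ) * (d + 1 + 2*e)
      = (d+1) * ((d+1+2*e).choose e : ℚ) := by exact_mod_cast h2
  have h5 : ((d + 1 + 2*e : ℕ) : ℚ) ≠ 0 := by positivity
  rw [div_mul_eq_mul_div, eq_div_iff h5]
  push_cast
  exact h4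
end

section
/- Let r(n,k) denote the number of partitions λ = (λ_1 ≥ … ≥ λ_{n−1} ≥ 0) with λ_i ≤ n−i for all i whose Durfee rank equals k. Then for all n ≥ 1 and all 0 ≤ k ≤ ⌊n/2⌋, r(n,k) = ( ((n+1−2k)/(n+1−k)) · C(n,k) )². -/
/-- The Durfee rank of a partition: the largest (1-based) index i with λ_i ≥ i,
and 0 if there is no such index. -/
def durfeeRank (n : ℕ) (f : Fin n → Fin n) : ℕ :=
  (Finset.univ.filter (fun i : Fin n => (i : ℕ) + 1 ≤ (f i : ℕ))).sup
    (fun i => (i : ℕ) + 1)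

/-- Sequences in the part to the right of the Durfee square. -/
def TopS (k m : ℕ) : Set (ℕ → ℕ) :=
  {a | Antitone a ∧ ∀ i, a i ≠ 0 → a i + i + 1 ≤ m ∧ i < k}

/-- Sequences in the part below the Durfee square. -/
def BotS (k m : ℕ) : Set (ℕ → ℕ) :=
  {a | Antitone a ∧ ∀ i, a i ≠ 0 → a i + i + 1 ≤ m ∧ a i ≤ k}

theorem ballot_aux (N : ℕ → ℕ → ℕ) (h0 : ∀ m, N 0 m = 1)
    (h1 : ∀ k, N (k+1) (k+1) = N k (k+1))
    (h2 : ∀ k m, k + 1 ≤ m → N (k+1) (m+1) = N k (m+1) + N (k+1) m) :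
    ∀ k m, k ≤ m → (N k m : ℚ) = ((m:ℚ) + 1 - k) / (m + 1) * Nat.choose (m + k) k := by
  have key : ∀ k m : ℕ, ((m:ℚ) + 1 + 1 - (k+1)) / (m + 1 + 1) * Nat.choose (m + 1 + (k + 1)) (k+1)
      = ((m:ℚ) + 1 + 1 - k) / (m + 1 + 1) * Nat.choose (m + 1 + k) k
        + ((m:ℚ) + 1 - (k+1)) / (m + 1) * Nat.choose (m + (k+1)) (k+1) := by
    intro k m
    have e1 := Nat.add_one_mul_choose_eq (m + 1 + k) k
    have e2 := Nat.choose_succ_succ (m + 1 + k) k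
    have r1 : m + 1 + (k+1) = m + 1 + k + 1 := by ring
    have r2 : m + (k+1) = m + 1 + k := by ring
    rw [r1, r2]
    simp only [Nat.succ_eq_add_one] at e2
    rw [e2] at e1 ⊢
    have e1' : ((m:ℚ) + 1 + k + 1) * Nat.choose (m+1+k) k
      = (Nat.choose (m+1+k) k + Nat.choose (m+1+k) (k+1)) * (k+1) := by exact_mod_cast e1
    push_cast
    have p1 : (m:ℚ) + 1 ≠ 0 := by positivity
    have p2 : (m:ℚ) + 1 + 1 ≠ 0 := by positivity
    generalize (Nat.choose (m+1+k) k : ℚ) = X at *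
    generalize (Nat.choose (m+1+k) (k+1) : ℚ) = Y at *
    field_simp
    linear_combination (-(1:ℚ)) * e1'
  intro k
  induction k with
  | zero =>
    intro m _
    have p1 : (m:ℚ) + 1 ≠ 0 := by positivity
    simp [h0, p1]
  | succ k ih =>
    intro m hm
    induction m, hm using Nat.le_induction with
    | base =>
      rw [h1, ih _ (by omega)]
      have := key k k
      push_cast at this ⊢
      rw [this]; simp
    | succ m hm ihm =>
      rw [h2 _ _ hm]
      have := key k m
      push_cast at this ⊢
      rw [ih _ (by omega), ihm, this]
      push_cast
      ring

theorem TopS_zero (m : ℕ) : TopS 0 m = {fun _ => 0} := by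
  ext a
  simp only [TopS, Set.mem_ofPred_eq, Set.mem_singleton_iff]
  constructor
  · rintro ⟨_, h⟩
    funext i
    by_contra h'
    have := h i h'
    omega
  · rintro rfl
    exact ⟨fun _ _ _ => le_rfl, by simp⟩

theorem BotS_zero (m : ℕ) : BotS 0 m = {fun _ => 0} := by
  ext a
  simp only [BotS, Set.mem_ofPred_eq, Set.mem_singleton_iff]
  constructor
  · rintro ⟨_, h⟩
    funext i
    by_contra h'
    have := h i h'
    omega
  · rintro rfl
    exact ⟨fun _ _ _ => le_rfl, by simp⟩

theorem TopS_diag (k : ℕ) : TopS (k+1) (k+1) = TopS k (k+1) := by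
  ext a
  simp only [TopS, Set.mem_ofPred_eq]
  constructor
  · rintro ⟨h1, h⟩
    refine ⟨h1, fun i hi => ?_⟩
    have := h i hi
    omega
  · rintro ⟨h1, h⟩
    refine ⟨h1, fun i hi => ?_⟩
    have := h i hi
    omega

theorem BotS_diag (k : ℕ) : BotS (k+1) (k+1) = BotS k (k+1) := by
  ext a
  simp only [BotS, Set.mem_ofPred_eq]
  constructor
  · rintro ⟨h1, h⟩
    refine ⟨h1, fun i hi => ?_⟩
    have := h i hi
    omega
  · rintro ⟨h1, h⟩
    refine ⟨h1, fun i hi => ?_⟩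
    have := h i hi
    omega

/-- add a column -/
def addCol (k : ℕ) (a : ℕ → ℕ) : ℕ → ℕ := fun i => if i ≤ k then a i + 1 else 0

/-- add a row -/
def addRow (k : ℕ) (a : ℕ → ℕ) : ℕ → ℕ := fun i => if i = 0 then k + 1 else a (i - 1)

theorem TopS_rec (k m : ℕ) (h : k + 1 ≤ m) :
    TopS (k+1) (m+1) = TopS k (m+1) ∪ addCol k '' TopS (k+1) m := by
  ext a
  simp only [Set.mem_union, Set.mem_image]
  constructor
  · rintro ⟨h1, h2⟩
    by_cases hk : a k = 0
    · left
      refine ⟨h1, fun i hi => ?_⟩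
      have := h2 i hi
      have h3 : i ≠ k := by rintro rfl; exact hi hk
      omega
    · right
      refine ⟨fun i => a i - 1, ⟨fun i j hij => Nat.sub_le_sub_right (h1 hij) 1, fun i hi => ?_⟩, ?_⟩
      · dsimp only at hi ⊢
        have := h2 i (by omega)
        omega
      · funext i
        simp only [addCol]
        split_ifs with hi
        · have := h1 hi
          omega
        · by_contra h3
          have := h2 i (by omega)
          omega
  · rintro (⟨h1, h2⟩ | ⟨b, ⟨h1, h2⟩, rfl⟩)
    · refine ⟨h1, fun i hi => ?_⟩
      have := h2 i hi
      omega
    · refine ⟨fun i j hij => ?_, fun i hi => ?_⟩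
      · have := h1 hij
        simp only [addCol]
        split_ifs <;> omega
      · have := h2 i
        simp only [addCol] at hi ⊢
        split_ifs at hi ⊢ <;> omega

theorem BotS_rec (k m : ℕ) (h : k + 1 ≤ m) :
    BotS (k+1) (m+1) = BotS k (m+1) ∪ addRow k '' BotS (k+1) m := by
  ext a
  simp only [Set.mem_union, Set.mem_image]
  constructor
  · rintro ⟨h1, h2⟩
    by_cases hk : a 0 ≤ k
    · left
      refine ⟨h1, fun i hi => ?_⟩
      have := h2 i hi
      have h3 := h1 (Nat.zero_le i)
      omega
    · right
      refine ⟨fun i => a (i + 1), ⟨fun i j hij => h1 (by omega), fun i hi => ?_⟩, ?_⟩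
      · dsimp only at hi ⊢
        have := h2 (i+1) hi
        omega
      · funext i
        simp only [addRow]
        split_ifs with hi
        · subst hi
          have := h2 0 (by omega)
          omega
        · congr 1; omega
  · rintro (⟨h1, h2⟩ | ⟨b, ⟨h1, h2⟩, rfl⟩)
    · refine ⟨h1, fun i hi => ?_⟩
      have := h2 i hi
      omega
    · refine ⟨fun i j hij => ?_, fun i hi => ?_⟩
      · have h3 : i - 1 ≤ j - 1 := by omega
        have := h1 h3
        have := h2 (j - 1)
        simp only [addRow]
        split_ifs <;> omega
      · have := h2 (i - 1)
        simp only [addRow] at hi ⊢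
        split_ifs at hi ⊢ <;> omega

theorem TopS_disj (k m : ℕ) : Disjoint (TopS k (m+1)) (addCol k '' TopS (k+1) m) := by
  rw [Set.disjoint_left]
  rintro _ ⟨_, h2⟩ ⟨b, _, rfl⟩
  have := h2 k
  simp [addCol] at this

theorem BotS_disj (k m : ℕ) : Disjoint (BotS k (m+1)) (addRow k '' BotS (k+1) m) := by
  rw [Set.disjoint_left]
  rintro _ ⟨_, h2⟩ ⟨b, _, rfl⟩
  have := h2 0
  simp [addRow] at this

theorem addCol_inj (k m : ℕ) : Set.InjOn (addCol k) (TopS (k+1) m) := by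
  rintro a ⟨_, ha⟩ b ⟨_, hb⟩ h
  funext i
  have h1 := congrFun h i
  have h2 := ha i
  have h3 := hb i
  simp only [addCol] at h1
  split_ifs at h1 <;> omega

theorem addRow_inj (k : ℕ) : Function.Injective (addRow k) := by
  intro a b h
  funext i
  have h1 := congrFun h (i+1)
  simpa [addRow] using h1

theorem TopS_fin (k : ℕ) : ∀ m, k ≤ m → (TopS k m).Finite := by
  induction k with
  | zero => intro m _; rw [TopS_zero]; exact Set.finite_singleton _
  | succ k ih =>
    intro m hm
    induction m, hm using Nat.le_induction with
    | base => rw [TopS_diag]; exact ih _ (by omega)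
    | succ m hm ihm => rw [TopS_rec _ _ hm]; exact (ih _ (by omega)).union (ihm.image _)

theorem BotS_fin (k : ℕ) : ∀ m, k ≤ m → (BotS k m).Finite := by
  induction k with
  | zero => intro m _; rw [BotS_zero]; exact Set.finite_singleton _
  | succ k ih =>
    intro m hm
    induction m, hm using Nat.le_induction with
    | base => rw [BotS_diag]; exact ih _ (by omega)
    | succ m hm ihm => rw [BotS_rec _ _ hm]; exact (ih _ (by omega)).union (ihm.image _)

theorem TopS_card : ∀ k m, k ≤ m →
    ((TopS k m).ncard : ℚ) = ((m:ℚ) + 1 - k) / (m + 1) * Nat.choose (m + k) k := by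
  apply ballot_aux (fun k m => (TopS k m).ncard)
  · intro m; simp [TopS_zero]
  · intro k; simp only [TopS_diag]
  · intro k m h
    try dsimp only
    rw [TopS_rec _ _ h, Set.ncard_union_eq (TopS_disj k m) (TopS_fin _ _ (by omega))
      ((TopS_fin _ _ h).image _), Set.ncard_image_of_injOn (addCol_inj k m)]

theorem BotS_card : ∀ k m, k ≤ m →
    ((BotS k m).ncard : ℚ) = ((m:ℚ) + 1 - k) / (m + 1) * Nat.choose (m + k) k := by
  apply ballot_aux (fun k m => (BotS k m).ncard)
  · intro m; simp [BotS_zero]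
  · intro k; simp only [BotS_diag]
  · intro k m h
    try dsimp only
    rw [BotS_rec _ _ h, Set.ncard_union_eq (BotS_disj k m) (BotS_fin _ _ (by omega))
      ((BotS_fin _ _ h).image _), Set.ncard_image_of_injective _ (addRow_inj k)]

theorem durfee_iff (n k : ℕ) (f : Fin n → Fin n) (hf : ∀ i j : Fin n, i ≤ j → f j ≤ f i)
    (hkn : k ≤ n) :
    durfeeRank n f = k ↔ ∀ i : Fin n, ((i:ℕ) < k → k ≤ f i) ∧ (k ≤ i → (f i : ℕ) ≤ k) := by
  have hle : ∀ j : Fin n, (j:ℕ) + 1 ≤ f j → (j:ℕ) + 1 ≤ durfeeRank n f := by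
    intro j hj
    exact Finset.le_sup (f := fun i : Fin n => (i : ℕ) + 1) (by simpa using hj)
  constructor
  · intro h i
    constructor
    · intro hi
      have hne : (Finset.univ.filter (fun i : Fin n => (i : ℕ) + 1 ≤ (f i : ℕ))).Nonempty := by
        by_contra hne
        rw [Finset.not_nonempty_iff_eq_empty] at hne
        rw [durfeeRank, hne] at h
        simp at h
        omega
      obtain ⟨j, hj, hj'⟩ := Finset.exists_mem_eq_sup _ hne (fun i : Fin n => (i : ℕ) + 1)
      rw [durfeeRank, hj'] at h
      simp only [Finset.mem_filter, Finset.mem_univ, true_and] at hj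
      have := hf i j (by rw [Fin.le_def]; omega)
      rw [Fin.le_def] at this
      omega
    · intro hi
      have hk : k < n := by omega
      have h1 := hf ⟨k, hk⟩ i (by rw [Fin.le_def]; exact hi)
      rw [Fin.le_def] at h1
      by_contra h2
      have := hle ⟨k, hk⟩ (by try dsimp only; omega)
      try dsimp only at this
      omega
  · intro h
    apply le_antisymm
    · apply Finset.sup_le
      intro j hj
      simp only [Finset.mem_filter, Finset.mem_univ, true_and] at hj
      have := (h j).2
      omega
    · rcases Nat.eq_zero_or_pos k with rfl | hk
      · exact Nat.zero_le _
      · have h1 := (h ⟨k - 1, by omega⟩).1 (by try dsimp only; omega)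
        have := hle ⟨k - 1, by omega⟩ (by try dsimp only; omega)
        try dsimp only at this
        omega

/-- Split a partition at its Durfee square. -/
def splitP (n k : ℕ) (f : Fin n → Fin n) : (ℕ → ℕ) × (ℕ → ℕ) :=
  (fun i => if h : i < n then (if i < k then (f ⟨i, h⟩ : ℕ) - k else 0) else 0,
   fun i => if h : k + i < n then (f ⟨k + i, h⟩ : ℕ) else 0)

theorem split_bij (n k : ℕ) (hn : 1 ≤ n) (hk : k ≤ n / 2) :
    Set.BijOn (splitP n k) ((Yn n).filter (fun f => durfeeRank n f = k) : Finset _)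
      (TopS k (n - k) ×ˢ BotS k (n - k)) := by
  have hmem : ∀ f : Fin n → Fin n,
      f ∈ (((Yn n).filter (fun f => durfeeRank n f = k) : Finset _) : Set (Fin n → Fin n)) ↔
      ((∀ i j : Fin n, i ≤ j → (f j : ℕ) ≤ f i) ∧ ∀ i : Fin n, (f i : ℕ) ≤ n - 1 - (i : ℕ)) ∧
      ∀ i : Fin n, ((i:ℕ) < k → k ≤ f i) ∧ (k ≤ i → (f i : ℕ) ≤ k) := by
    intro f
    simp only [Yn, Finset.coe_filter, Finset.mem_filter, Finset.mem_univ, true_and,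
      Set.mem_ofPred_eq]
    constructor
    · rintro ⟨⟨h1, h2⟩, h3⟩
      exact ⟨⟨h1, h2⟩, (durfee_iff n k f h1 (by omega)).1 h3⟩
    · rintro ⟨⟨h1, h2⟩, h3⟩
      exact ⟨⟨h1, h2⟩, (durfee_iff n k f h1 (by omega)).2 h3⟩
  refine ⟨?_, ?_, ?_⟩
  · intro f hf
    obtain ⟨⟨h1, h2⟩, h3⟩ := (hmem f).1 hf
    refine ⟨⟨fun i j hij => ?_, fun i hi => ?_⟩, ⟨fun i j hij => ?_, fun i hi => ?_⟩⟩
    · simp only [splitP]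
      split_ifs with a b c d <;> try omega
      have := h1 ⟨i, c⟩ ⟨j, a⟩ hij
      omega
    · simp only [splitP] at hi ⊢
      split_ifs at hi ⊢ with a b <;> try omega
      have := h2 ⟨i, a⟩
      try dsimp only at this
      omega
    · simp only [splitP]
      split_ifs with a b <;> try omega
      exact h1 ⟨k + i, b⟩ ⟨k + j, a⟩ (by rw [Fin.le_def]; try dsimp only; omega)
    · simp only [splitP] at hi ⊢
      split_ifs at hi ⊢ with a <;> try omega
      have := h2 ⟨k + i, a⟩
      have := (h3 ⟨k + i, a⟩).2
      try dsimp only at *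
      omega
  · intro f hf g hg hfg
    obtain ⟨⟨f1, f2⟩, f3⟩ := (hmem f).1 hf
    obtain ⟨⟨g1, g2⟩, g3⟩ := (hmem g).1 hg
    funext i
    apply Fin.ext
    by_cases hi : (i:ℕ) < k
    · have := congrFun (congrArg Prod.fst hfg) i
      simp only [splitP, i.2, hi, dif_pos, if_pos, Fin.eta] at this
      have := (f3 i).1 hi
      have := (g3 i).1 hi
      omega
    · have := congrFun (congrArg Prod.snd hfg) (i - k)
      have e : k + ((i:ℕ) - k) = i := by omega
      simpa only [splitP, e, i.2, dif_pos, Fin.eta] using this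
  · rintro ⟨a, b⟩ ⟨⟨a1, a2⟩, ⟨b1, b2⟩⟩
    try dsimp only at a1 a2 b1 b2
    have hb : ∀ i, b i ≤ k := by
      intro i
      have := b2 i
      omega
    have hval : ∀ i : Fin n, (if (i:ℕ) < k then k + a i else b (i - k)) ≤ n - 1 - (i:ℕ) := by
      intro i
      have := a2 i
      have := b2 (i - k)
      split_ifs <;> omega
    let F : Fin n → Fin n := fun i =>
      ⟨if (i:ℕ) < k then k + a i else b (i - k), by have := hval i; omega⟩
    have hF : ∀ i : Fin n, (F i : ℕ) = if (i:ℕ) < k then k + a i else b (i - k) := fun i => rfl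
    refine ⟨F, (hmem F).2 ⟨⟨fun i j hij => ?_, fun i => hval i⟩, fun i => ?_⟩, ?_⟩
    · rw [hF, hF]
      rw [Fin.le_def] at hij
      have := a1 hij
      have := b1 (show (i:ℕ) - k ≤ j - k by omega)
      have := hb (j - k)
      split_ifs <;> omega
    · rw [hF]
      have := hb (i - k)
      constructor <;> intro _ <;> split_ifs <;> omega
    · apply Prod.ext
      · funext i
        simp only [splitP, hF]
        have := a2 i
        split_ifs <;> omega
      · funext i
        simp only [splitP, hF]
        have := b2 i
        have e : k + i - k = i := by omega
        rw [e]
        split_ifs <;> omega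

/-- The number of partitions fitting inside the staircase (n−1,…,1) of Durfee
rank k is (((n+1−2k)/(n+1−k))·C(n,k))². -/
theorem stmt8 (n k : ℕ) (hn : 1 ≤ n) (hk : k ≤ n / 2) :
    (((Yn n).filter (fun f => durfeeRank n f = k)).card : ℚ)
      = ((((n : ℚ) + 1 - 2 * k) / ((n : ℚ) + 1 - k)) * Nat.choose n k) ^ 2 := by
  have hb := split_bij n k hn hk
  rw [← Set.ncard_coe_finset, ← Set.ncard_image_of_injOn hb.injOn, hb.image_eq, Set.ncard_prod]
  push_cast
  rw [TopS_card _ _ (by omega), BotS_card _ _ (by omega)]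
  have e : n - k + k = n := by omega
  rw [e, Nat.cast_sub (by omega)]
  have e1 : (n:ℚ) - k + 1 - k = n + 1 - 2 * k := by ring
  have e2 : (n:ℚ) - k + 1 = n + 1 - k := by ring
  rw [e1, e2]
  ring
end

section
/- For every 132-avoiding permutation π of {1,…,n} (n ≥ 1), the maximum length of a decreasing subsequence of π is equal to des(π) + 1, where des(π) is the number of descents of π. -/
theorem exists_des_between {n : ℕ} (π : Equiv.Perm (Fin n)) (i : Fin n) :
    ∀ (k : ℕ) (h : i.val + k < n), π ⟨i.val + k, h⟩ < π i →
      ∃ d ∈ DesFinset π, i.val ≤ d.val ∧ d.val < i.val + k := by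
  intro k
  induction k with
  | zero => intro h hlt; exact absurd hlt (lt_irrefl _)
  | succ k ih =>
    intro h hlt
    by_cases hk : π ⟨i.val + k, by omega⟩ < π i
    · obtain ⟨d, hd, h1, h2⟩ := ih (by omega) hk
      exact ⟨d, hd, h1, by omega⟩
    · refine ⟨⟨i.val + k, by omega⟩, ?_, by simp, by simp⟩
      simp only [DesFinset, Finset.mem_filter, Finset.mem_univ, true_and]
      exact ⟨h, lt_of_lt_of_le hlt (not_lt.mp hk)⟩

theorem lt_of_start {n : ℕ} (π : Equiv.Perm (Fin n)) (hπ : Avoids π pat132)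
    (s d : Fin n) (h : d.val + 1 < n) (hd : π ⟨d.val + 1, h⟩ < π d) (hs : s.val ≤ d.val) :
    π ⟨d.val + 1, h⟩ < π s := by
  by_contra hc
  rw [not_lt] at hc
  have hne : s ≠ ⟨d.val + 1, h⟩ := by
    intro e
    have := congrArg Fin.val e
    simp at this
    omega
  have hlt : π s < π ⟨d.val + 1, h⟩ := lt_of_le_of_ne hc (fun e => hne (π.injective e))
  have hsd : s < d := by
    rcases Nat.lt_or_eq_of_le hs with h1 | h1
    · exact h1
    · have : s = d := Fin.ext h1
      subst this
      exact absurd hlt (lt_asymm hd)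
  have hdd : d < ⟨d.val + 1, h⟩ := by rw [Fin.lt_def]; simp
  apply hπ
  have e0 : pat132 0 = 0 := by decide
  have e1 : pat132 1 = 2 := by decide
  have e2 : pat132 2 = 1 := by decide
  refine ⟨![s, d, ⟨d.val + 1, h⟩], ?_, ?_⟩
  · intro a b hab
    fin_cases a <;> fin_cases b <;> first
      | exact absurd hab (by decide)
      | exact hsd
      | exact hdd
      | exact hsd.trans hdd
  · have hx := hlt.trans hd
    intro a b
    fin_cases a <;> fin_cases b <;>
      simp [e0, e1, e2, hlt, hd, hx, hlt.le, hd.le, hx.le]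

/-- For a 132-avoiding permutation π, the maximum length of a decreasing
subsequence of π equals des(π) + 1: there is a decreasing subsequence of this
length, and no longer one. -/
theorem stmt9 (n : ℕ) (hn : 1 ≤ n) (π : Equiv.Perm (Fin n))
    (hπ : Avoids π pat132) :
    (∃ f : Fin ((DesFinset π).card + 1) → Fin n,
        (∀ a b, a < b → f a < f b) ∧ (∀ a b, a < b → π (f b) < π (f a))) ∧
    (∀ (m : ℕ) (f : Fin m → Fin n),
        (∀ a b, a < b → f a < f b) → (∀ a b, a < b → π (f b) < π (f a)) →
        m ≤ (DesFinset π).card + 1) := by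
  constructor
  · classical
    let g : Fin n → ℕ := fun i => i.val + 1
    let S : Finset (Fin n) := Finset.univ.filter
      (fun t => t.val = 0 ∨ ∃ d ∈ DesFinset π, d.val + 1 = t.val)
    have hS : S.card = (DesFinset π).card + 1 := by
      have : S.image Fin.val = insert 0 ((DesFinset π).image g) := by
        ext x
        simp only [S, g, Finset.mem_image, Finset.mem_filter, Finset.mem_univ, true_and,
          Finset.mem_insert]
        constructor
        · rintro ⟨a, h | h, rfl⟩
          · exact Or.inl h
          · exact Or.inr h
        · rintro (rfl | ⟨d, hd, rfl⟩)
          · exact ⟨⟨0, hn⟩, Or.inl rfl, rfl⟩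
          · have hd' := hd
            simp only [DesFinset, Finset.mem_filter, Finset.mem_univ, true_and] at hd'
            obtain ⟨h, _⟩ := hd'
            exact ⟨⟨d.val + 1, h⟩, Or.inr ⟨d, hd, rfl⟩, rfl⟩
      rw [← Finset.card_image_of_injective S Fin.val_injective, this,
        Finset.card_insert_of_notMem (by simp [g]),
        Finset.card_image_of_injective _ (fun a b hab => Fin.ext (by simpa [g] using hab))]
    refine ⟨S.orderEmbOfFin hS, fun a b hab => (S.orderEmbOfFin hS).strictMono hab, ?_⟩
    intro a b hab
    have hlt := (S.orderEmbOfFin hS).strictMono hab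
    have hb := S.orderEmbOfFin_mem hS b
    generalize S.orderEmbOfFin hS a = s at *
    generalize S.orderEmbOfFin hS b = t at *
    simp only [S, Finset.mem_filter, Finset.mem_univ, true_and] at hb
    rw [Fin.lt_def] at hlt
    rcases hb with hb | ⟨d, hd, hdt⟩
    · omega
    · simp only [DesFinset, Finset.mem_filter, Finset.mem_univ, true_and] at hd
      obtain ⟨h, hd⟩ := hd
      have : t = ⟨d.val + 1, h⟩ := Fin.ext hdt.symm
      rw [this]
      exact lt_of_start π hπ s d h hd (by omega)
  · intro m f hf hdec
    let c : Fin m → ℕ := fun a => ((DesFinset π).filter (fun d => d < f a)).card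
    have hc : StrictMono c := by
      intro a b hab
      have h1 := hf a b hab
      have h2 := hdec a b hab
      have h3 : (f a).val + ((f b).val - (f a).val) = (f b).val := by
        rw [Fin.lt_def] at h1; omega
      have h4 : (⟨(f a).val + ((f b).val - (f a).val), h3.trans_lt (f b).isLt⟩ : Fin n) = f b :=
        Fin.ext h3
      obtain ⟨d, hd, h5, h6⟩ := exists_des_between π (f a) ((f b).val - (f a).val)
        (h3.trans_lt (f b).isLt) (by rw [h4]; exact h2)
      apply Finset.card_lt_card
      rw [Finset.ssubset_iff_of_subset]
      · refine ⟨d, ?_, ?_⟩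
        · rw [Finset.mem_filter, Fin.lt_def]
          exact ⟨hd, by omega⟩
        · rw [Finset.mem_filter, Fin.lt_def]
          omega
      · intro x hx
        rw [Finset.mem_filter] at hx ⊢
        exact ⟨hx.1, hx.2.trans h1⟩
    have := Finset.card_le_card_of_injOn (s := Finset.univ)
      (t := Finset.range ((DesFinset π).card + 1)) c
      (fun a _ => by
        simp only [Finset.coe_range, Set.mem_Iio]
        exact Nat.lt_succ_of_le (Finset.card_filter_le _ _))
      (hc.injective.injOn)
    simpa using this
end

section
/- Let k ≥ 3 and let π ∈ S_n be a 132-avoiding permutation not equal to the identity. Then π avoids the decreasing pattern k (k−1) ⋯ 2 1 if and only if the diagram D(π) has at most k−2 corners, where a corner of D(π) is a cell (i,j) ∈ D(π) with (i+1,j) ∉ D(π) and (i,j+1) ∉ D(π). In particular, in that case des(π) ≤ k−2. -/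
/-- The diagram of a permutation: cells (i,j) (0-indexed) with j < π i and i < π⁻¹ j. -/
def DiagramF {n : ℕ} (π : Equiv.Perm (Fin n)) : Finset (Fin n × Fin n) :=
  Finset.univ.filter (fun p => p.2 < π p.1 ∧ p.1 < π.symm p.2)

/-- The corners of the diagram: cells (i,j) in D(π) with (i+1,j) ∉ D(π) and
(i,j+1) ∉ D(π). -/
def DCorners {n : ℕ} (π : Equiv.Perm (Fin n)) : Finset (Fin n × Fin n) :=
  (DiagramF π).filter (fun p =>
    (∀ h : (p.1 : ℕ) + 1 < n, (⟨(p.1 : ℕ) + 1, h⟩, p.2) ∉ DiagramF π) ∧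
    (∀ h : (p.2 : ℕ) + 1 < n, (p.1, ⟨(p.2 : ℕ) + 1, h⟩) ∉ DiagramF π))

theorem av132 {n : ℕ} {π : Equiv.Perm (Fin n)} (hπ : Avoids π pat132) {a b c : Fin n}
    (h1 : a < b) (h2 : b < c) (h3 : π a < π c) (h4 : π c < π b) : False := by
  apply hπ
  refine ⟨![a, b, c], ?_, ?_⟩
  · intro x y hxy
    fin_cases x <;> fin_cases y <;> simp at hxy ⊢ <;> first | assumption | exact h1.trans h2 | (exfalso; revert hxy; decide)
  · have e0 : pat132 0 = 0 := by decide
    have e1 : pat132 1 = 2 := by decide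
    have e2 : pat132 2 = 1 := by decide
    have h5 := h3.trans h4
    intro x y
    fin_cases x <;> fin_cases y <;> simp [e0, e1, e2, h3, h4, h5, h3.le, h4.le, h5.le]

theorem mem_diag {n : ℕ} (π : Equiv.Perm (Fin n)) (i j : Fin n) :
    (i, j) ∈ DiagramF π ↔ j < π i ∧ i < π.symm j := by
  simp [DiagramF]

theorem corner_des {n : ℕ} {π : Equiv.Perm (Fin n)} (hπ : Avoids π pat132) :
    (DCorners π).card = (DesFinset π).card := by
  refine Finset.card_bij (fun p _ => p.1) ?_ ?_ ?_
  · rintro ⟨i, j⟩ h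
    simp only [DCorners, Finset.mem_filter, mem_diag] at h
    obtain ⟨⟨h1, h2⟩, h3, -⟩ := h
    have hi : (i : ℕ) + 1 < n := by have := (π.symm j).2; have : (i : ℕ) < π.symm j := h2; omega
    simp only [DesFinset, Finset.mem_filter, Finset.mem_univ, true_and]
    refine ⟨hi, ?_⟩
    by_contra hc
    apply h3 hi
    have h4 : j < π ⟨i + 1, hi⟩ := lt_of_lt_of_le h1 (not_lt.mp hc)
    refine ⟨h4, ?_⟩
    refine lt_of_le_of_ne ?_ ?_
    · rw [Fin.le_def]; exact h2
    · intro he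
      have : π ⟨i + 1, hi⟩ = j := by rw [he]; simp
      exact absurd h4 (by rw [this]; exact lt_irrefl _)
  · have key : ∀ i j j' : Fin n, (i, j) ∈ DCorners π → (i, j') ∈ DCorners π → ¬ j < j' := by
      intro i j j' h h' hlt
      simp only [DCorners, Finset.mem_filter, mem_diag] at h h'
      obtain ⟨⟨h1, h2⟩, -, h3⟩ := h
      obtain ⟨⟨h1', h2'⟩, -, -⟩ := h'
      have hj : (j : ℕ) + 1 < n := by have := j'.2; have : (j : ℕ) < j' := hlt; omega
      have hle : (⟨j + 1, hj⟩ : Fin n) ≤ j' := by rw [Fin.le_def]; exact hlt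
      have hlt2 : (⟨j + 1, hj⟩ : Fin n) < π i := lt_of_le_of_lt hle h1'
      have h4 : ¬ i < π.symm ⟨j + 1, hj⟩ := fun h => h3 hj ⟨hlt2, h⟩
      have h5 : π.symm ⟨j + 1, hj⟩ < i := by
        refine lt_of_le_of_ne (not_lt.mp h4) ?_
        intro he
        rw [← he] at hlt2
        simp at hlt2
      have h6 : (⟨j + 1, hj⟩ : Fin n) < j' := by
        refine lt_of_le_of_ne hle ?_
        intro he
        rw [← he] at h2'
        exact h4 h2'
      exact av132 hπ h5 h2' (by simpa using h6) (by simpa using h1')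
    rintro ⟨i, j⟩ h ⟨i', j'⟩ h' he
    simp only at he
    subst he
    rcases lt_trichotomy j j' with h0 | h0 | h0
    · exact absurd h0 (key _ _ _ h h')
    · rw [h0]
    · exact absurd h0 (key _ _ _ h' h)
  · intro i hi
    simp only [DesFinset, Finset.mem_filter, Finset.mem_univ, true_and] at hi
    obtain ⟨hi, hd⟩ := hi
    let T : Finset (Fin n) := Finset.univ.filter (fun j => (i, j) ∈ DiagramF π)
    have hT : π ⟨i + 1, hi⟩ ∈ T := by
      simp only [T, Finset.mem_filter, Finset.mem_univ, true_and, mem_diag]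
      refine ⟨hd, ?_⟩
      simp [Fin.lt_def]
    have hm := T.max'_mem ⟨_, hT⟩
    have hM : ∀ j ∈ T, j ≤ T.max' ⟨_, hT⟩ := fun j hj => T.le_max' j hj
    generalize T.max' ⟨_, hT⟩ = m at hm hM
    refine ⟨(i, m), ?_, rfl⟩
    simp only [DCorners, Finset.mem_filter]
    refine ⟨by simpa [T] using hm, ?_, ?_⟩
    · intro h hc
      rw [mem_diag] at hc
      exact absurd hc.1 (not_lt.mpr (hM _ hT))
    · intro h hc
      have := hM ⟨m + 1, h⟩ (by simpa [T] using hc)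
      rw [Fin.le_def] at this
      simp at this

theorem exists_des {n : ℕ} (π : Equiv.Perm (Fin n)) (a b : Fin n) (hab : a < b) (h : π b < π a) :
    ∃ i ∈ DesFinset π, a ≤ i ∧ i < b := by
  by_contra hc
  push Not at hc
  have : ∀ m : ℕ, ∀ hm : a + m < n, a + m ≤ (b : ℕ) → π a ≤ π ⟨a + m, hm⟩ := by
    intro m
    induction m with
    | zero => intro _ _; exact le_rfl
    | succ m ih =>
      intro hm hb
      have hm' : (a : ℕ) + m < n := by omega
      refine (ih hm' (by omega)).trans ?_
      by_contra hlt
      have := hc ⟨a + m, hm'⟩ (by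
        simp only [DesFinset, Finset.mem_filter, Finset.mem_univ, true_and]
        exact ⟨hm, not_le.mp hlt⟩) (by simp [Fin.le_def])
      simp only [Fin.le_def] at this
      omega
  have hab' : (a : ℕ) < b := hab
  have h2 := this (b - a) (by have := b.2; omega) (by omega)
  have e : (⟨a + (b - a), by have := b.2; omega⟩ : Fin n) = b := by ext; simp; omega
  rw [e] at h2
  exact absurd h (not_lt.mpr h2)

theorem contains_iff {n k : ℕ} (hk : 3 ≤ k) (π : Equiv.Perm (Fin n))
    (hπ : Avoids π pat132) :
    Contains π (Fin.revPerm : Equiv.Perm (Fin k)) ↔ k - 1 ≤ (DesFinset π).card := by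
  constructor
  · rintro ⟨f, hf, hr⟩
    have H : ∀ a : Fin (k - 1), ∃ i ∈ DesFinset π,
        f ⟨a, by omega⟩ ≤ i ∧ i < f ⟨a + 1, by omega⟩ := by
      intro a
      apply exists_des
      · apply hf; simp [Fin.lt_def]
      · rw [← hr]; simp [Fin.lt_def]; omega
    choose g hg hg1 hg2 using H
    have mono : StrictMono g := by
      intro a b hab
      refine (hg2 a).trans_le (le_trans ?_ (hg1 b))
      have hfm : StrictMono f := fun a b h => hf a b h
      apply hfm.monotone
      rw [Fin.le_def]
      exact hab
    have := Finset.card_le_card_of_injOn (s := Finset.univ) (t := DesFinset π) g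
      (fun a _ => hg a) (mono.injective.injOn)
    simpa using this
  · intro h
    have hn : 0 < n := by
      rcases Nat.eq_zero_or_pos n with h0 | h0
      · subst h0
        have : (DesFinset π).card ≤ 0 := by simpa using Finset.card_le_univ (DesFinset π)
        omega
      · exact h0
    let S : Finset (Fin n) := Finset.univ.filter (fun i => ∀ j < i, π i < π j)
    have h0 : (⟨0, hn⟩ : Fin n) ∈ S := by
      simp only [S, Finset.mem_filter, Finset.mem_univ, true_and]
      intro j hj
      exact absurd hj (by rw [Fin.lt_def]; simp)
    have hc : (DesFinset π).card ≤ (S.erase ⟨0, hn⟩).card := by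
      apply Finset.card_le_card_of_injOn
        (fun i : Fin n => if h : (i : ℕ) + 1 < n then (⟨i + 1, h⟩ : Fin n) else i)
      · intro i hi
        simp only [DesFinset, Finset.coe_filter, Finset.mem_univ, true_and, Set.mem_setOf_eq] at hi
        obtain ⟨hi, hd⟩ := hi
        simp only [hi, dif_pos, Finset.mem_coe, Finset.mem_erase, S, Finset.mem_filter,
          Finset.mem_univ, true_and]
        refine ⟨by simp [Fin.ext_iff], ?_⟩
        intro j hj
        rcases lt_trichotomy j i with hji | hji | hji
        · by_contra hlt
          refine av132 hπ hji (c := ⟨i + 1, hi⟩) (by simp [Fin.lt_def]) ?_ hd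
          refine lt_of_le_of_ne (not_lt.mp hlt) ?_
          intro he
          exact hj.ne (π.injective he)
        · rw [hji]; exact hd
        · simp only [Fin.lt_def] at hji hj; omega
      · intro i hi j hj hij
        simp only [DesFinset, Finset.coe_filter, Finset.mem_univ, true_and, Set.mem_setOf_eq] at hi hj
        obtain ⟨hi, -⟩ := hi
        obtain ⟨hj, -⟩ := hj
        simp only [hi, hj, dif_pos, Fin.ext_iff] at hij
        ext; omega
    rw [Finset.card_erase_of_mem h0] at hc
    have hS : k ≤ S.card := by omega
    let e := S.orderEmbOfCardLe hS
    have he : ∀ a, e a ∈ S := fun a => Finset.orderEmbOfCardLe_mem S hS a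
    have hd : ∀ a b, a < b → π (e b) < π (e a) := by
      intro a b hab
      have := he b
      simp only [S, Finset.mem_filter, Finset.mem_univ, true_and] at this
      exact this _ (e.strictMono hab)
    refine ⟨e, fun a b hab => e.strictMono hab, ?_⟩
    intro a b
    simp only [Fin.revPerm_apply, Fin.rev_lt_rev]
    constructor
    · exact hd b a
    · intro hlt
      by_contra hba
      rcases (not_lt.mp hba).lt_or_eq with h1 | h1
      · exact absurd hlt (hd a b h1).asymm
      · rw [h1] at hlt; exact lt_irrefl _ hlt

theorem stmt10 (n k : ℕ) (hk : 3 ≤ k) (π : Equiv.Perm (Fin n))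
    (hπ : Avoids π pat132) (hne : π ≠ 1) :
    (Avoids π (Fin.revPerm : Equiv.Perm (Fin k)) ↔ (DCorners π).card ≤ k - 2) ∧
    (Avoids π (Fin.revPerm : Equiv.Perm (Fin k)) → (DesFinset π).card ≤ k - 2) := by
  have h : Avoids π (Fin.revPerm : Equiv.Perm (Fin k)) ↔ (DesFinset π).card ≤ k - 2 := by
    rw [Avoids, contains_iff hk π hπ]
    omega
  rw [corner_des hπ]
  exact ⟨h, h.1⟩
end

section
/- Let k ≥ 3 and let π ∈ S_n be a 132-avoiding permutation. Then π avoids the increasing pattern 1 2 ⋯ k if and only if the diagram D(π) contains the Young diagram of the staircase partition (n+1−k, n−k, …, 1), i.e., every cell (i,j) with i ≥ 1, j ≥ 1 and i + j ≤ n + 2 − k belongs to D(π). Equivalently, π(i) + i ≥ n + 3 − k for every i ∈ {1,…,n}. -/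
theorem aux_mono {n : ℕ} (π : Equiv.Perm (Fin n)) (hπ : Avoids π pat132)
    (i a b : Fin n) (h1 : i < a) (h2 : a < b) (h3 : π i < π b) : π a < π b := by
  by_contra hc
  have hne : π a ≠ π b := fun h => h2.ne (π.injective h)
  have hlt : π b < π a := lt_of_le_of_ne (not_lt.mp hc) hne.symm
  apply hπ
  have e0 : pat132 0 = 0 := by decide
  have e1 : pat132 1 = 2 := by decide
  have e2 : pat132 2 = 1 := by decide
  refine ⟨![i, a, b], ?_, ?_⟩
  · intro x y hxy
    fin_cases x <;> fin_cases y <;> simp_all <;> omega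
  · intro x y
    fin_cases x <;> fin_cases y <;> simp [e0, e1, e2] <;> omega

theorem aux_contains {n k : ℕ} (π : Equiv.Perm (Fin n)) (hπ : Avoids π pat132)
    (i : Fin n) (hi : (π i : ℕ) + (i : ℕ) + k ≤ n) : Contains π (1 : Equiv.Perm (Fin k)) := by
  classical
  let S : Finset (Fin n) := Finset.univ.filter (fun j => i ≤ j ∧ π i ≤ π j)
  have hS : k ≤ S.card := by
    have hsub : (Finset.univ : Finset (Fin n)) ⊆
        S ∪ (Finset.Iio i ∪ (Finset.Iio (π i)).map π.symm.toEmbedding) := by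
      intro j _
      simp only [S, Finset.mem_union, Finset.mem_filter, Finset.mem_univ, true_and,
        Finset.mem_Iio, Finset.mem_map_equiv, Equiv.symm_symm]
      by_cases h1 : j < i
      · exact Or.inr (Or.inl h1)
      · by_cases h2 : π j < π i
        · exact Or.inr (Or.inr h2)
        · exact Or.inl ⟨not_lt.mp h1, not_lt.mp h2⟩
    have h1 := Finset.card_le_card hsub
    have h2 := Finset.card_union_le S (Finset.Iio i ∪ (Finset.Iio (π i)).map π.symm.toEmbedding)
    have h3 := Finset.card_union_le (Finset.Iio i) ((Finset.Iio (π i)).map π.symm.toEmbedding)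
    simp only [Finset.card_univ, Fintype.card_fin, Finset.card_map, Fin.card_Iio] at h1 h2 h3
    omega
  obtain ⟨T, hTS, hT⟩ := Finset.exists_subset_card_eq hS
  have key : ∀ a b : Fin k, a < b → π (T.orderEmbOfFin hT a) < π (T.orderEmbOfFin hT b) := by
    intro a b hab
    have ha := hTS (T.orderEmbOfFin_mem hT a)
    have hb := hTS (T.orderEmbOfFin_mem hT b)
    have hlt := (T.orderEmbOfFin hT).strictMono hab
    generalize T.orderEmbOfFin hT a = x at *
    generalize T.orderEmbOfFin hT b = y at *
    simp only [S, Finset.mem_filter, Finset.mem_univ, true_and] at ha hb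
    have hiy : π i < π y := by
      refine lt_of_le_of_ne hb.2 fun h => ?_
      have := π.injective h
      omega
    rcases eq_or_lt_of_le ha.1 with h | h
    · rw [← h]; exact hiy
    · exact aux_mono π hπ i x y h hlt hiy
  refine ⟨T.orderEmbOfFin hT, fun a b h => (T.orderEmbOfFin hT).strictMono h, fun a b => ?_⟩
  have hm : StrictMono (fun a => π (T.orderEmbOfFin hT a)) := fun a b h => key a b h
  exact (hm.lt_iff_lt (a := a) (b := b)).symm

theorem aux_conv {n k : ℕ} (hk : 3 ≤ k) (π : Equiv.Perm (Fin n))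
    (hc : Contains π (1 : Equiv.Perm (Fin k))) :
    ∃ i : Fin n, (π i : ℕ) + (i : ℕ) + k ≤ n := by
  classical
  obtain ⟨f, hf, hg⟩ := hc
  let z : Fin k := ⟨0, by omega⟩
  obtain ⟨m, hm, hmin⟩ := Finset.exists_min_image (Finset.Iic (f z)) π ⟨f z, by simp⟩
  simp only [Finset.mem_Iic] at hm hmin
  refine ⟨m, ?_⟩
  have hfm : StrictMono f := fun a b h => hf a b h
  have hz : ∀ a, z ≤ a := fun a => by simp [z, Fin.le_def]
  have hπz : ∀ a, π (f z) ≤ π (f a) := by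
    intro a
    rcases eq_or_lt_of_le (hz a) with h | h
    · rw [← h]
    · exact ((hg z a).1 (by simpa using h)).le
  let A := (Finset.univ : Finset (Fin k)).image f
  let B := Finset.Iio m
  let C := (Finset.Iio (π m)).map π.symm.toEmbedding
  have hA : A.card = k := by
    simp [A, Finset.card_image_of_injective _ hfm.injective]
  have hBC : Disjoint B C := by
    rw [Finset.disjoint_left]
    intro x hx hx'
    simp only [B, C, Finset.mem_Iio, Finset.mem_map_equiv, Equiv.symm_symm] at hx hx'
    exact absurd (hmin x (hx.le.trans hm)) (not_le.mpr hx')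
  have hABC : Disjoint A (B ∪ C) := by
    rw [Finset.disjoint_left]
    intro x hx hx'
    simp only [A, B, C, Finset.mem_union, Finset.mem_image, Finset.mem_univ, true_and,
      Finset.mem_Iio, Finset.mem_map_equiv, Equiv.symm_symm] at hx hx'
    obtain ⟨a, rfl⟩ := hx
    have h1 := hfm.monotone (hz a)
    have h2 := hπz a
    have h3 := hmin (f z) le_rfl
    rcases hx' with h | h
    · exact absurd (hm.trans h1) (not_le.mpr h)
    · exact absurd (h3.trans h2) (not_le.mpr h)
  have h := Finset.card_le_univ (A ∪ (B ∪ C))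
  rw [Finset.card_union_of_disjoint hABC, Finset.card_union_of_disjoint hBC, hA] at h
  simp only [B, C, Fintype.card_fin, Finset.card_map, Fin.card_Iio] at h
  omega

/-- For a 132-avoiding permutation π and k ≥ 3: π avoids the increasing pattern
12⋯k iff its diagram contains the staircase (n+1−k, n−k, …, 1), i.e. every cell
(i,j) with i + j ≤ n + 2 − k (1-based; equivalently i + j + k ≤ n in 0-based
coordinates) lies in D(π); equivalently π(i) + i ≥ n + 3 − k for every i
(equivalently n + 1 ≤ π(i) + i + k in 0-based coordinates). -/
theorem stmt11 (n k : ℕ) (hk : 3 ≤ k) (π : Equiv.Perm (Fin n))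
    (hπ : Avoids π pat132) :
    (Avoids π (1 : Equiv.Perm (Fin k)) ↔
      ∀ p : Fin n × Fin n, (p.1 : ℕ) + (p.2 : ℕ) + k ≤ n → p ∈ DiagramF π) ∧
    (Avoids π (1 : Equiv.Perm (Fin k)) ↔
      ∀ i : Fin n, n + 1 ≤ (π i : ℕ) + (i : ℕ) + k) := by
  have h3 : Avoids π (1 : Equiv.Perm (Fin k)) ↔
      ∀ i : Fin n, n + 1 ≤ (π i : ℕ) + (i : ℕ) + k := by
    constructor
    · intro h i
      by_contra hc
      exact h (aux_contains π hπ i (by omega))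
    · intro h hc
      obtain ⟨i, hi⟩ := aux_conv hk π hc
      have := h i
      omega
  refine ⟨h3.trans ⟨?_, ?_⟩, h3⟩
  · rintro h ⟨i, j⟩ hij
    simp only [DiagramF, Finset.mem_filter, Finset.mem_univ, true_and, Fin.lt_def] at hij ⊢
    have h1 := h i
    have h2 := h (π.symm j)
    rw [Equiv.apply_symm_apply] at h2
    omega
  · intro h i
    by_contra hc
    have := h (i, π i) (by simp only; omega)
    simp [DiagramF] at this
end
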